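/- arXiv:1205.5342 — 2 statements merged into one kernel-verified Lean document; each statement's English description precedes it below -/
import Mathlib

section
/- Let Ω = ℝ²/ℤ², let γ > 1, and let M₁, M₂ > 0. There exists a constant C depending only on M₁, M₂, γ, Ω such that for every v ∈ H¹(Ω) and every nonnegative measurable function ρ on Ω with ∫_Ω ρ dx ≥ M₁ and ∫_Ω ρ^γ dx ≤ M₂, one has ‖v‖_{L²(Ω)}² ≤ C ∫_Ω ρ v² dx + C ‖∇v‖_{L²(Ω)}². -/
open MeasureTheory Real

noncomputable section

/-- The fundamental domain of the torus `Ω = ℝ²/ℤ²` (unit square). -/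
def Q2 : Set (ℝ × ℝ) := Set.Ioo 0 1 ×ˢ Set.Ioo 0 1

/-- Lebesgue measure on the torus, identified with the unit square. -/
def μΩ : MeasureTheory.Measure (ℝ × ℝ) := MeasureTheory.volume.restrict Q2

/-- `ℤ²`-periodicity of a function on `ℝ²`. -/
def Per {α : Type*} (f : ℝ × ℝ → α) : Prop :=
  (∀ x : ℝ × ℝ, f (x.1 + 1, x.2) = f x) ∧ (∀ x : ℝ × ℝ, f (x.1, x.2 + 1) = f x)

/-- First partial derivative of a scalar function on `ℝ²`. -/
def d1 (f : ℝ × ℝ → ℝ) (x : ℝ × ℝ) : ℝ := fderiv ℝ f x (1, 0)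

/-- Second partial derivative of a scalar function on `ℝ²`. -/
def d2 (f : ℝ × ℝ → ℝ) (x : ℝ × ℝ) : ℝ := fderiv ℝ f x (0, 1)

lemma aux_oneD (f f' g : ℝ → ℝ) (hf : ∀ t, HasDerivAt f (f' t) t) (hg : Measurable g)
    (hfg : ∀ t, |f' t| ≤ g t) (a b : ℝ) (ha : a ∈ Set.Ioo (0:ℝ) 1) (hb : b ∈ Set.Ioo (0:ℝ) 1) :
    ENNReal.ofReal ((f a - f b) ^ 2) ≤ ∫⁻ t in Set.Ioo (0:ℝ) 1, ENNReal.ofReal (g t ^ 2) := by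
  wlog hab : a ≤ b generalizing a b
  · have := this b a hb ha (le_of_not_ge hab)
    rwa [show (f a - f b) ^ 2 = (f b - f a) ^ 2 by ring]
  by_cases htop : (∫⁻ t in Set.Ioo (0:ℝ) 1, ENNReal.ofReal (g t ^ 2)) = ⊤
  · rw [htop]; exact le_top
  set μ : Measure ℝ := volume.restrict (Set.Ioo (0:ℝ) 1) with hμ
  have hprob : IsProbabilityMeasure μ := ⟨by simp [hμ]⟩
  have hsq : Integrable (fun t => g t ^ 2) μ := by
    refine ⟨(hg.pow_const 2).aestronglyMeasurable, ?_⟩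
    rw [hasFiniteIntegral_iff_ofReal (Filter.Eventually.of_forall fun t => sq_nonneg _)]
    exact lt_top_iff_ne_top.2 htop
  have hgi : Integrable g μ :=
    ((memLp_two_iff_integrable_sq hg.aestronglyMeasurable).2 hsq).integrable (by norm_num)
  have hf'm : Measurable f' := by
    have : f' = deriv f := funext fun t => (hf t).deriv.symm
    rw [this]; exact measurable_deriv f
  have hf'i : Integrable f' μ :=
    hgi.mono' hf'm.aestronglyMeasurable (Filter.Eventually.of_forall hfg)
  have hsub : Set.Ioc a b ⊆ Set.Ioo (0:ℝ) 1 := fun t ht => ⟨ha.1.trans ht.1, ht.2.trans_lt hb.2⟩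
  have hFTC : ∫ t in a..b, f' t = f b - f a := by
    apply intervalIntegral.integral_eq_sub_of_hasDerivAt (fun t _ => hf t)
    rw [intervalIntegrable_iff_integrableOn_Ioc_of_le hab]
    exact IntegrableOn.mono_set hf'i hsub
  have h1 : |f b - f a| ≤ ∫ t, g t ∂μ := by
    rw [← hFTC, intervalIntegral.integral_of_le hab]
    calc |∫ t in Set.Ioc a b, f' t| ≤ ∫ t in Set.Ioc a b, |f' t| := abs_integral_le_integral_abs
      _ ≤ ∫ t in Set.Ioo (0:ℝ) 1, |f' t| :=
        setIntegral_mono_set hf'i.abs (Filter.Eventually.of_forall fun t => abs_nonneg _)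
          hsub.eventuallyLE
      _ ≤ ∫ t, g t ∂μ := integral_mono hf'i.abs hgi hfg
  have h2 : (∫ t, g t ∂μ) ^ 2 ≤ ∫ t, g t ^ 2 ∂μ := by
    set m := ∫ t, g t ∂μ with hm
    have h0 : 0 ≤ ∫ t, (g t - m) ^ 2 ∂μ := integral_nonneg fun t => sq_nonneg _
    have he : ∫ t, (g t - m) ^ 2 ∂μ = ∫ t, g t ^ 2 ∂μ - 2 * m * m + m ^ 2 := by
      have : ∀ t, (g t - m) ^ 2 = g t ^ 2 - 2 * m * g t + m ^ 2 := fun t => by ring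
      simp_rw [this]
      have hd : Integrable (fun t => g t ^ 2 - 2 * m * g t) μ := hsq.sub (hgi.const_mul _)
      rw [integral_add hd (integrable_const _),
        integral_sub hsq (hgi.const_mul _), integral_const_mul]
      simp [hm]
    nlinarith
  rw [← ofReal_integral_eq_lintegral_ofReal hsq (Filter.Eventually.of_forall fun t => sq_nonneg _)]
  apply ENNReal.ofReal_le_ofReal
  refine le_trans ?_ h2
  rw [show (f a - f b) ^ 2 = |f b - f a| ^ 2 by rw [sq_abs]; ring]
  gcongr

lemma aux_mu : μΩ = (volume.restrict (Set.Ioo (0:ℝ) 1)).prod (volume.restrict (Set.Ioo (0:ℝ) 1)) := by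
  rw [Measure.prod_restrict]; rfl

lemma aux_diff (v : ℝ × ℝ → ℝ) (hv : Differentiable ℝ v) (x y : ℝ × ℝ) (hx : x ∈ Q2) (hy : y ∈ Q2) :
    ENNReal.ofReal ((v x - v y) ^ 2) ≤
      2 * (∫⁻ t in Set.Ioo (0:ℝ) 1, ENNReal.ofReal (‖fderiv ℝ v (t, x.2)‖ ^ 2)) +
      2 * (∫⁻ t in Set.Ioo (0:ℝ) 1, ENNReal.ofReal (‖fderiv ℝ v (y.1, t)‖ ^ 2)) := by
  have hm : Measurable (fun z => ‖fderiv ℝ v z‖) := (measurable_fderiv ℝ v).norm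
  have hA := aux_oneD (fun t => v (t, x.2)) (fun t => fderiv ℝ v (t, x.2) (1, 0))
    (fun t => ‖fderiv ℝ v (t, x.2)‖)
    (fun t => (hv (t, x.2)).hasFDerivAt.comp_hasDerivAt t
      ((hasDerivAt_id t).prodMk (hasDerivAt_const t x.2)))
    (hm.comp (by fun_prop))
    (fun t => by
      have := (fderiv ℝ v (t, x.2)).le_opNorm (1, 0)
      simpa [Prod.norm_def] using this) x.1 y.1 hx.1 hy.1
  have hB := aux_oneD (fun t => v (y.1, t)) (fun t => fderiv ℝ v (y.1, t) (0, 1))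
    (fun t => ‖fderiv ℝ v (y.1, t)‖)
    (fun t => (hv (y.1, t)).hasFDerivAt.comp_hasDerivAt t
      ((hasDerivAt_const t y.1).prodMk (hasDerivAt_id t)))
    (hm.comp (by fun_prop))
    (fun t => by
      have := (fderiv ℝ v (y.1, t)).le_opNorm (0, 1)
      simpa [Prod.norm_def] using this) x.2 y.2 hx.2 hy.2
  refine le_trans ?_ (add_le_add (mul_le_mul_right hA 2) (mul_le_mul_right hB 2))
  rw [show (2:ENNReal) = ENNReal.ofReal 2 by simp, ← ENNReal.ofReal_mul (by norm_num),
    ← ENNReal.ofReal_mul (by norm_num), ← ENNReal.ofReal_add (by positivity) (by positivity)]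
  apply ENNReal.ofReal_le_ofReal
  have e1 : v (x.1, x.2) = v x := rfl
  have e2 : v (y.1, y.2) = v y := rfl
  rw [e1, e2]
  nlinarith [sq_nonneg (v x - v (y.1, x.2) - (v (y.1, x.2) - v y))]

lemma aux_norm (f : ℝ × ℝ → ℝ) : eLpNorm f 2 μΩ ^ 2 = ∫⁻ x, ENNReal.ofReal (f x ^ 2) ∂μΩ := by
  have := eLpNorm_nnreal_pow_eq_lintegral (f := f) (μ := μΩ) (p := 2) (by norm_num)
  simp only [NNReal.coe_ofNat, ENNReal.coe_ofNat, ENNReal.rpow_ofNat] at this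
  rw [this]
  congr 1; ext x
  rw [← ofReal_norm, ← ENNReal.ofReal_pow (norm_nonneg _), norm_eq_abs, sq_abs]

lemma aux_weight (γ M₁ M₂ K : ℝ) (hγ : 1 < γ) (hK : 0 < K) (hKM : M₂ * K ^ (1 - γ) ≤ M₁ / 2)
    (ρ : ℝ × ℝ → ℝ) (hm : Measurable ρ) (h0 : ∀ x, 0 ≤ ρ x)
    (hi : Integrable ρ μΩ) (h1 : M₁ ≤ ∫ x in Q2, ρ x)
    (hi2 : Integrable (fun x => ρ x ^ γ) μΩ) (h2 : (∫ x in Q2, ρ x ^ γ) ≤ M₂) :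
    ENNReal.ofReal (M₁ / 2) ≤ ∫⁻ x, ENNReal.ofReal (min (ρ x) K) ∂μΩ := by
  have hw0 : ∀ x, 0 ≤ min (ρ x) K := fun x => le_min (h0 x) hK.le
  have hwi : Integrable (fun x => min (ρ x) K) μΩ := by
    refine hi.mono' (hm.min measurable_const).aestronglyMeasurable
      (Filter.Eventually.of_forall fun x => ?_)
    rw [norm_eq_abs, abs_of_nonneg (hw0 x)]; exact min_le_left _ _
  rw [← ofReal_integral_eq_lintegral_ofReal hwi (Filter.Eventually.of_forall hw0)]
  apply ENNReal.ofReal_le_ofReal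
  have hp : ∀ x, ρ x ≤ min (ρ x) K + ρ x ^ γ * K ^ (1 - γ) := by
    intro x
    rcases le_total (ρ x) K with h | h
    · rw [min_eq_left h]
      have := mul_nonneg (rpow_nonneg (h0 x) γ) (rpow_nonneg hK.le (1 - γ))
      linarith
    · have hpos : 0 < ρ x := hK.trans_le h
      have e : ρ x = ρ x ^ γ * ρ x ^ (1 - γ) := by
        rw [← rpow_add hpos]; simp
      have : ρ x ^ (1 - γ) ≤ K ^ (1 - γ) := rpow_le_rpow_of_nonpos hK h (by linarith)
      have := mul_le_mul_of_nonneg_left this (rpow_nonneg (h0 x) γ)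
      linarith [hw0 x]
  have := integral_mono hi (hwi.add (hi2.mul_const _)) hp
  simp only [Pi.add_apply] at this
  rw [integral_add hwi (hi2.mul_const _), integral_mul_const] at this
  have h3 := mul_le_mul_of_nonneg_right h2 (rpow_nonneg hK.le (1 - γ))
  change M₁ ≤ ∫ x, ρ x ∂μΩ at h1
  change (∫ x, ρ x ^ γ ∂μΩ) * _ ≤ _ at h3
  linarith

lemma aux_main (K : ℝ) (hK : 0 < K) (v ρ : ℝ × ℝ → ℝ) (hv : Differentiable ℝ v)
    (hm : Measurable ρ) (h0 : ∀ x, 0 ≤ ρ x) :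
    (∫⁻ x, ENNReal.ofReal (min (ρ x) K) ∂μΩ) * (∫⁻ x, ENNReal.ofReal (v x ^ 2) ∂μΩ) ≤
      2 * (∫⁻ x, ENNReal.ofReal (ρ x * v x ^ 2) ∂μΩ) +
      ENNReal.ofReal (8 * K) * (∫⁻ x, ENNReal.ofReal (‖fderiv ℝ v x‖ ^ 2) ∂μΩ) := by
  have hprob1 : IsProbabilityMeasure (volume.restrict (Set.Ioo (0:ℝ) 1)) := ⟨by simp⟩
  have hprob : IsProbabilityMeasure μΩ := by rw [aux_mu]; infer_instance
  have hvm : Measurable v := hv.continuous.measurable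
  set G : ℝ × ℝ → ENNReal := fun x => ENNReal.ofReal (‖fderiv ℝ v x‖ ^ 2) with hG
  have hGm : Measurable G := (((measurable_fderiv ℝ v).norm).pow_const 2).ennreal_ofReal
  set A : ℝ → ENNReal := fun s => ∫⁻ t in Set.Ioo (0:ℝ) 1, G (t, s) with hA
  set B : ℝ → ENNReal := fun s => ∫⁻ t in Set.Ioo (0:ℝ) 1, G (s, t) with hB
  have hAm : Measurable A := hGm.lintegral_prod_left'
  have hBm : Measurable B := hGm.lintegral_prod_right'
  have hAi : ∫⁻ x, A x.2 ∂μΩ = ∫⁻ x, G x ∂μΩ := by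
    rw [aux_mu, lintegral_prod_symm _ hGm.aemeasurable,
      lintegral_prod (fun x : ℝ × ℝ => A x.2) (hAm.comp measurable_snd).aemeasurable]
    simp [hA]
  have hBi : ∫⁻ x, B x.1 ∂μΩ = ∫⁻ x, G x ∂μΩ := by
    rw [aux_mu, lintegral_prod _ hGm.aemeasurable,
      lintegral_prod (fun x : ℝ × ℝ => B x.1) (hBm.comp measurable_fst).aemeasurable]
    simp [hB]
  have hQ : ∀ᵐ x ∂μΩ, x ∈ Q2 :=
    ae_restrict_mem (measurableSet_Ioo.prod measurableSet_Ioo)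
  have hpt : ∀ x ∈ Q2, ∀ y ∈ Q2,
      ENNReal.ofReal (min (ρ y) K) * ENNReal.ofReal (v x ^ 2) ≤
      2 * ENNReal.ofReal (ρ y * v y ^ 2) + ENNReal.ofReal (4 * K) * (A x.2 + B y.1) := by
    intro x hx y hy
    have hd := aux_diff v hv x y hx hy
    have hw0 : 0 ≤ min (ρ y) K := le_min (h0 y) hK.le
    calc ENNReal.ofReal (min (ρ y) K) * ENNReal.ofReal (v x ^ 2)
        ≤ 2 * ENNReal.ofReal (ρ y * v y ^ 2) +
          ENNReal.ofReal (2 * K) * ENNReal.ofReal ((v x - v y) ^ 2) := by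
          have := mul_nonneg (h0 y) (sq_nonneg (v y))
          rw [show (2:ENNReal) = ENNReal.ofReal 2 by simp, ← ENNReal.ofReal_mul hw0,
            ← ENNReal.ofReal_mul (by norm_num), ← ENNReal.ofReal_mul (by positivity),
            ← ENNReal.ofReal_add (by positivity) (by positivity)]
          apply ENNReal.ofReal_le_ofReal
          have i1 : v x ^ 2 ≤ 2 * v y ^ 2 + 2 * (v x - v y) ^ 2 := by
            nlinarith [sq_nonneg (v x - 2 * v y)]
          have i2 := mul_le_mul_of_nonneg_left i1 hw0
          have i3 := mul_le_mul_of_nonneg_right (min_le_left (ρ y) K) (sq_nonneg (v y))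
          have i4 := mul_le_mul_of_nonneg_right (min_le_right (ρ y) K) (sq_nonneg (v x - v y))
          linarith
      _ ≤ 2 * ENNReal.ofReal (ρ y * v y ^ 2) +
          ENNReal.ofReal (2 * K) * (2 * A x.2 + 2 * B y.1) := by
          gcongr
      _ = _ := by
          rw [show 4 * K = 2 * K * 2 by ring, ENNReal.ofReal_mul (p := 2 * K) (by positivity),
            ← mul_add, mul_assoc]
          simp
  have hx : ∀ y ∈ Q2, ENNReal.ofReal (min (ρ y) K) * (∫⁻ x, ENNReal.ofReal (v x ^ 2) ∂μΩ) ≤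
      2 * ENNReal.ofReal (ρ y * v y ^ 2) +
        ENNReal.ofReal (4 * K) * ((∫⁻ x, G x ∂μΩ) + B y.1) := by
    intro y hy
    rw [← lintegral_const_mul _ (by fun_prop)]
    refine (lintegral_mono_ae (hQ.mono fun x hx => hpt x hx y hy)).trans_eq ?_
    have hA2 : Measurable fun x : ℝ × ℝ => A x.2 := hAm.comp measurable_snd
    rw [lintegral_add_left measurable_const, lintegral_const_mul _ (hA2.add_const _),
      lintegral_add_left hA2, hAi]
    simp
  have hB2 : Measurable fun x : ℝ × ℝ => B x.1 := hBm.comp measurable_fst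
  rw [← lintegral_mul_const _ (by fun_prop)]
  refine (lintegral_mono_ae (hQ.mono hx)).trans_eq ?_
  rw [lintegral_add_left (by fun_prop), lintegral_const_mul _ (by fun_prop),
    lintegral_const_mul _ (hB2.const_add _), lintegral_add_left measurable_const, hBi]
  simp only [lintegral_const, measure_univ, mul_one]
  rw [show 8 * K = 4 * K * 2 by ring, ENNReal.ofReal_mul (p := 4 * K) (by positivity), ← two_mul,
    mul_assoc]
  simp

/-- weighted Poincaré-type inequality. For `γ > 1`, `M₁, M₂ > 0`
there is `C = C(M₁, M₂, γ, Ω)` such that for every `v ∈ H¹(Ω)` and every nonnegative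
`ρ` with `∫ρ ≥ M₁` and `∫ρ^γ ≤ M₂`, `‖v‖_{L²}² ≤ C ∫ρv² + C‖∇v‖_{L²}²`. -/
theorem stmt2 (γ M₁ M₂ : ℝ) (hγ : 1 < γ) (hM₁ : 0 < M₁) (hM₂ : 0 < M₂) :
    ∃ C > 0, ∀ v : ℝ × ℝ → ℝ, ∀ ρ : ℝ × ℝ → ℝ,
      Per v → Differentiable ℝ v → Per ρ → Measurable ρ → (∀ x, 0 ≤ ρ x) →
      MeasureTheory.Integrable ρ μΩ → M₁ ≤ ∫ x in Q2, ρ x →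
      MeasureTheory.Integrable (fun x => ρ x ^ γ) μΩ → (∫ x in Q2, ρ x ^ γ) ≤ M₂ →
      MeasureTheory.eLpNorm v 2 μΩ ^ 2 ≤
        ENNReal.ofReal C * (∫⁻ x, ENNReal.ofReal (ρ x * v x ^ 2) ∂μΩ) +
          ENNReal.ofReal C * MeasureTheory.eLpNorm (fun x => ‖fderiv ℝ v x‖) 2 μΩ ^ 2 := by
  set K : ℝ := (2 * M₂ / M₁) ^ (1 / (γ - 1)) with hKdef
  have hbase : 0 < 2 * M₂ / M₁ := by positivity
  have hK : 0 < K := rpow_pos_of_pos hbase _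
  have hKM : M₂ * K ^ (1 - γ) ≤ M₁ / 2 := by
    have hne : γ - 1 ≠ 0 := by linarith
    rw [hKdef, ← rpow_mul hbase.le, show 1 / (γ - 1) * (1 - γ) = -1 by field_simp; ring,
      rpow_neg_one]
    apply le_of_eq
    field_simp
  refine ⟨(8 * K + 2) * (2 / M₁), by positivity, ?_⟩
  intro v ρ _ hv _ hm h0 hi h1 hi2 h2
  have hW := aux_weight γ M₁ M₂ K hγ hK hKM ρ hm h0 hi h1 hi2 h2
  have hmain := (mul_le_mul_left hW _).trans (aux_main K hK v ρ hv hm h0)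
  rw [aux_norm, aux_norm]
  set N := ∫⁻ x, ENNReal.ofReal (v x ^ 2) ∂μΩ
  set R := ∫⁻ x, ENNReal.ofReal (ρ x * v x ^ 2) ∂μΩ
  set D := ∫⁻ x, ENNReal.ofReal (‖fderiv ℝ v x‖ ^ 2) ∂μΩ
  calc N = ENNReal.ofReal (2 / M₁) * (ENNReal.ofReal (M₁ / 2) * N) := by
        rw [← mul_assoc, ← ENNReal.ofReal_mul (by positivity),
          show 2 / M₁ * (M₁ / 2) = 1 by field_simp]
        simp
    _ ≤ ENNReal.ofReal (2 / M₁) * (2 * R + ENNReal.ofReal (8 * K) * D) := by gcongr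
    _ ≤ ENNReal.ofReal (2 / M₁) *
        (ENNReal.ofReal (8 * K + 2) * R + ENNReal.ofReal (8 * K + 2) * D) := by
        have e2 : (2:ENNReal) ≤ ENNReal.ofReal (8 * K + 2) := by
          rw [show (2:ENNReal) = ENNReal.ofReal 2 by simp]
          exact ENNReal.ofReal_le_ofReal (by linarith)
        gcongr
        linarith
    _ = _ := by
        rw [mul_comm (8 * K + 2) (2 / M₁), ENNReal.ofReal_mul (p := 2 / M₁) (by positivity)]
        ring
end
end

section
/- Let Ω = ℝ²/ℤ² and let q₁, q₂, q₃ ∈ (1,∞) satisfy 1/q₁ = 1/q₂ + 1/q₃. There is a constant C depending only on q₁, q₂, q₃ such that for all smooth b, f on Ω and i, j ∈ {1,2}, ‖∇[b, R_iR_j](f)‖_{L^{q₁}} ≤ C ‖∇b‖_{L^{q₂}} ‖f‖_{L^{q₃}}, where [b, R_iR_j](f) = b R_iR_j(f) - R_iR_j(bf) and R_i are the periodic Riesz transforms. -/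
open MeasureTheory Real

noncomputable section

/-- The character `e^{2πi n·x}` of the torus, `n ∈ ℤ²`. -/
def ch (n : ℤ × ℤ) (x : ℝ × ℝ) : ℂ :=
  Complex.exp (2 * Real.pi * Complex.I * ((n.1 : ℂ) * (x.1 : ℂ) + (n.2 : ℂ) * (x.2 : ℂ)))

/-- Fourier coefficient of a function on the torus. -/
def fc (f : ℝ × ℝ → ℂ) (n : ℤ × ℤ) : ℂ := ∫ x in Q2, f x * (starRingEnd ℂ) (ch n x)

/-- `i`-th component of a frequency `n ∈ ℤ²`, as a complex number. -/
def nc (n : ℤ × ℤ) : Fin 2 → ℂ := ![(n.1 : ℂ), (n.2 : ℂ)]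

/-- The periodic Riesz transform `R_i = (-Δ)^{-1/2} ∂_i`, defined as the Fourier
multiplier with symbol `i n_i / |n|` (and `0` on the zero frequency). -/
def Rz (i : Fin 2) (f : ℝ × ℝ → ℂ) (x : ℝ × ℝ) : ℂ :=
  ∑' n : ℤ × ℤ, if n = 0 then 0 else
    (Complex.I * nc n i / ((Real.sqrt ((n.1 : ℝ) ^ 2 + (n.2 : ℝ) ^ 2) : ℝ) : ℂ)) *
      fc f n * ch n x

/-- The composition `R_i ∘ R_j` of two periodic Riesz transforms: the Fourier
multiplier with symbol `-n_i n_j / |n|²` (and `0` on the zero frequency). -/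
def RRz (i j : Fin 2) (f : ℝ × ℝ → ℂ) (x : ℝ × ℝ) : ℂ :=
  ∑' n : ℤ × ℤ, if n = 0 then 0 else
    (-(nc n i * nc n j) / ((((n.1 : ℝ) ^ 2 + (n.2 : ℝ) ^ 2 : ℝ)) : ℂ)) * fc f n * ch n x

/-- The commutator `[b, R_iR_j](f) = b R_iR_j(f) - R_iR_j(bf)`. -/
def commRR (b f : ℝ × ℝ → ℂ) (i j : Fin 2) (x : ℝ × ℝ) : ℂ :=
  b x * RRz i j f x - RRz i j (fun y => b y * f y) x

/-- The BMO seminorm of a function on the torus (balls of radius at most `2`,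
which exceeds the diameter of the fundamental domain). -/
def bmo (b : ℝ × ℝ → ℝ) : ENNReal :=
  ⨆ (x : ℝ × ℝ) (r : Set.Ioc (0 : ℝ) 2),
    (MeasureTheory.volume (Metric.ball x (r : ℝ)))⁻¹ *
      ∫⁻ y in Metric.ball x (r : ℝ),
        ENNReal.ofReal |b y - ⨍ z in Metric.ball x (r : ℝ), b z|

noncomputable section

set_option linter.unusedSectionVars false
open Set Filter Topology
open scoped ContDiff

/-- smooth periodic functions -/
def Sm {V : Type} [NormedAddCommGroup V] [NormedSpace ℝ V] (f : ℝ × ℝ → V) : Prop :=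
  Per f ∧ ContDiff ℝ ∞ f

/-- coordinate vectors -/
def ee (k : Fin 2) : ℝ × ℝ := ![(1, 0), (0, 1)] k

/-- partial derivatives -/
def D {V : Type} [NormedAddCommGroup V] [NormedSpace ℝ V] (k : Fin 2) (f : ℝ × ℝ → V) :
    ℝ × ℝ → V := fun x => fderiv ℝ f x (ee k)

section
variable {V : Type} [NormedAddCommGroup V] [NormedSpace ℝ V]

lemma Per.int {α : Type*} {f : ℝ × ℝ → α} (h : Per f) (m n : ℤ) (x : ℝ × ℝ) :
    f (x.1 + m, x.2 + n) = f x := by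
  have h1 : ∀ y, Function.Periodic (fun s => f (s, y)) 1 := fun y s => h.1 (s, y)
  have h2 : ∀ s, Function.Periodic (fun y => f (s, y)) 1 := fun s y => h.2 (s, y)
  have a := (h1 (x.2 + n)).int_mul m x.1
  have b := (h2 x.1).int_mul n x.2
  simp only [mul_one] at a b
  rw [a, b]

lemma Per.exists_bound {f : ℝ × ℝ → V} (h : Per f) (hc : Continuous f) :
    ∃ C, 0 ≤ C ∧ ∀ x, ‖f x‖ ≤ C := by
  have hK : IsCompact (Icc (0:ℝ) 1 ×ˢ Icc (0:ℝ) 1) := isCompact_Icc.prod isCompact_Icc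
  obtain ⟨C, hC⟩ := hK.exists_bound_of_continuousOn (f := f) hc.continuousOn
  have key : ∀ x, ‖f x‖ ≤ C := by
    intro x
    have e := h.int (-⌊x.1⌋) (-⌊x.2⌋) x
    rw [← e]
    apply hC
    have a1 := Int.floor_le x.1
    have a2 := Int.lt_floor_add_one x.1
    have a3 := Int.floor_le x.2
    have a4 := Int.lt_floor_add_one x.2
    push_cast
    refine ⟨⟨?_, ?_⟩, ⟨?_, ?_⟩⟩ <;> simp only <;> linarith
  exact ⟨C, (norm_nonneg _).trans (key 0), key⟩

lemma Sm.cont {f : ℝ × ℝ → V} (h : Sm f) : Continuous f := h.2.continuous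
lemma Sm.diff {f : ℝ × ℝ → V} (h : Sm f) : Differentiable ℝ f := h.2.differentiable (by simp)

lemma Sm.bound {f : ℝ × ℝ → V} (h : Sm f) : ∃ C, 0 ≤ C ∧ ∀ x, ‖f x‖ ≤ C :=
  h.1.exists_bound h.cont

lemma Per.fderiv {f : ℝ × ℝ → V} (h : Per f) : Per (fderiv ℝ f) := by
  constructor
  · intro x
    have e : f = fun y => f (y + (1, 0)) := by
      funext y
      have := h.1 y
      rw [← this]; congr 1; ext <;> simp
    conv_rhs => rw [e]
    rw [fderiv_comp_add_right]
    congr 1; ext <;> simp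
  · intro x
    have e : f = fun y => f (y + (0, 1)) := by
      funext y
      have := h.2 y
      rw [← this]; congr 1; ext <;> simp
    conv_rhs => rw [e]
    rw [fderiv_comp_add_right]
    congr 1; ext <;> simp

lemma Sm.fderiv {f : ℝ × ℝ → V} (h : Sm f) : Sm (fderiv ℝ f) :=
  ⟨h.1.fderiv, h.2.fderiv_right (by simp)⟩

lemma Sm.D {f : ℝ × ℝ → V} (h : Sm f) (k : Fin 2) : Sm (D k f) := by
  refine ⟨⟨fun x => ?_, fun x => ?_⟩, ?_⟩
  · simp only [_root_.D]; rw [h.1.fderiv.1]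
  · simp only [_root_.D]; rw [h.1.fderiv.2]
  · exact h.fderiv.2.clm_apply contDiff_const

lemma Sm.add {f g : ℝ × ℝ → V} (hf : Sm f) (hg : Sm g) : Sm (f + g) :=
  ⟨⟨fun x => by simp [hf.1.1, hg.1.1], fun x => by simp [hf.1.2, hg.1.2]⟩, hf.2.add hg.2⟩
lemma Sm.neg {f : ℝ × ℝ → V} (hf : Sm f) : Sm (-f) :=
  ⟨⟨fun x => by simp [hf.1.1], fun x => by simp [hf.1.2]⟩, hf.2.neg⟩
lemma Sm.sub {f g : ℝ × ℝ → V} (hf : Sm f) (hg : Sm g) : Sm (f - g) :=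
  ⟨⟨fun x => by simp [hf.1.1, hg.1.1], fun x => by simp [hf.1.2, hg.1.2]⟩, hf.2.sub hg.2⟩
lemma Sm.smul {f : ℝ × ℝ → V} (c : ℝ) (hf : Sm f) : Sm (c • f) :=
  ⟨⟨fun x => by simp [hf.1.1], fun x => by simp [hf.1.2]⟩, hf.2.const_smul c⟩
lemma Sm.mul {f g : ℝ × ℝ → ℝ} (hf : Sm f) (hg : Sm g) : Sm (f * g) :=
  ⟨⟨fun x => by simp [hf.1.1, hg.1.1], fun x => by simp [hf.1.2, hg.1.2]⟩, hf.2.mul hg.2⟩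
lemma Sm.mulC {f g : ℝ × ℝ → ℂ} (hf : Sm f) (hg : Sm g) : Sm (f * g) :=
  ⟨⟨fun x => by simp [hf.1.1, hg.1.1], fun x => by simp [hf.1.2, hg.1.2]⟩, hf.2.mul hg.2⟩
lemma Sm.const (c : V) : Sm (fun _ : ℝ × ℝ => c) :=
  ⟨⟨fun _ => rfl, fun _ => rfl⟩, contDiff_const⟩

/-- pointwise power -/
def pw (c : ℝ) (f : ℝ × ℝ → ℝ) : ℝ × ℝ → ℝ := fun x => f x ^ c

lemma Sm.pw {f : ℝ × ℝ → ℝ} (c : ℝ) (hf : Sm f) (h0 : ∀ x, 0 < f x) : Sm (pw c f) :=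
  ⟨⟨fun x => by simp [_root_.pw, hf.1.1], fun x => by simp [_root_.pw, hf.1.2]⟩,
    hf.2.rpow_const_of_ne (fun x => (h0 x).ne')⟩

lemma D_add {f g : ℝ × ℝ → V} (k : Fin 2) (hf : Sm f) (hg : Sm g) : D k (f + g) = D k f + D k g := by
  funext x; simp [D, fderiv_add (hf.diff x) (hg.diff x)]
lemma D_sub {f g : ℝ × ℝ → V} (k : Fin 2) (hf : Sm f) (hg : Sm g) : D k (f - g) = D k f - D k g := by
  funext x; simp [D, fderiv_sub (hf.diff x) (hg.diff x)]
lemma D_smul {f : ℝ × ℝ → V} (k : Fin 2) (c : ℝ) (hf : Sm f) : D k (c • f) = c • D k f := by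
  funext x; simp [D, fderiv_const_smul (hf.diff x)]
lemma D_mul {f g : ℝ × ℝ → ℝ} (k : Fin 2) (hf : Sm f) (hg : Sm g) :
    D k (f * g) = f * D k g + D k f * g := by
  funext x; simp [D, fderiv_mul (hf.diff x) (hg.diff x)]; ring
lemma D_mulC {f g : ℝ × ℝ → ℂ} (k : Fin 2) (hf : Sm f) (hg : Sm g) :
    D k (f * g) = f * D k g + D k f * g := by
  funext x; simp [D, fderiv_mul (hf.diff x) (hg.diff x)]; ring
lemma D_pw {f : ℝ × ℝ → ℝ} (k : Fin 2) (c : ℝ) (hf : Sm f) (h0 : ∀ x, 0 < f x) :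
    D k (pw c f) = fun x => c * f x ^ (c - 1) * D k f x := by
  funext x
  have := ((hf.diff x).hasFDerivAt.rpow_const (p := c) (Or.inl (h0 x).ne')).fderiv
  unfold D pw
  rw [this]; simp

lemma D_comm {f : ℝ × ℝ → V} (i j : Fin 2) (hf : Sm f) : D i (D j f) = D j (D i f) := by
  funext x
  have hs : IsSymmSndFDerivAt ℝ f x := by
    apply hf.2.contDiffAt.isSymmSndFDerivAt
    rw [minSmoothness_of_isRCLikeNormedField]; exact WithTop.coe_le_coe.2 le_top
  have h : ∀ i j, D i (D j f) x = fderiv ℝ (fderiv ℝ f) x (ee i) (ee j) := by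
    intro i j
    have hd : DifferentiableAt ℝ (fderiv ℝ f) x := hf.fderiv.diff x
    change fderiv ℝ (fun y => fderiv ℝ f y (ee j)) x (ee i) = _
    rw [fderiv_clm_apply hd (differentiableAt_const _)]
    simp
  rw [h, h]; exact hs.eq _ _

lemma Q2_meas : MeasurableSet Q2 := measurableSet_Ioo.prod measurableSet_Ioo
lemma Q2_sub : Q2 ⊆ Icc (0:ℝ) 1 ×ˢ Icc (0:ℝ) 1 := prod_mono Ioo_subset_Icc_self Ioo_subset_Icc_self
lemma Q2_vol : volume Q2 = 1 := by
  rw [Q2, Measure.volume_eq_prod, Measure.prod_prod]; simp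
instance : IsProbabilityMeasure (volume.restrict Q2) := ⟨by simp [Q2_vol]⟩

lemma intOn {f : ℝ × ℝ → V} (hf : Continuous f) : IntegrableOn f Q2 :=
  (hf.continuousOn.integrableOn_compact (isCompact_Icc.prod isCompact_Icc)).mono_set Q2_sub

lemma HasFDerivAt_D {f : ℝ × ℝ → V} {x : ℝ × ℝ} {L : ℝ × ℝ →L[ℝ] V} (h : HasFDerivAt f L x) (k) : D k f x = L (ee k) := by
  simp [D, h.fderiv]

lemma int_Q2 {f : ℝ × ℝ → V} (hf : Continuous f) :
    ∫ x in Q2, f x = ∫ s in (0:ℝ)..1, ∫ t in (0:ℝ)..1, f (s, t) := by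
  rw [Q2, Measure.volume_eq_prod, setIntegral_prod]
  · simp only [intervalIntegral.integral_of_le zero_le_one, integral_Ioc_eq_integral_Ioo]
  · exact intOn hf

lemma int_Q2' {f : ℝ × ℝ → V} (hf : Continuous f) :
    ∫ x in Q2, f x = ∫ t in (0:ℝ)..1, ∫ s in (0:ℝ)..1, f (s, t) := by
  rw [Q2, Measure.volume_eq_prod, ← setIntegral_prod_swap, setIntegral_prod]
  · simp only [intervalIntegral.integral_of_le zero_le_one, integral_Ioc_eq_integral_Ioo, Prod.swap]
  · exact intOn (hf.comp continuous_swap)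

lemma line_deriv {f : ℝ × ℝ → V} (hf : Sm f) (x v : ℝ × ℝ) (t : ℝ) :
    HasDerivAt (fun t : ℝ => f (x + t • v)) (fderiv ℝ f (x + t • v) v) t := by
  have h1 : HasDerivAt (fun t : ℝ => x + t • v) v t := by
    simpa using ((hasDerivAt_id t).smul_const v).const_add x
  exact (hf.diff _).hasFDerivAt.comp_hasDerivAt t h1

lemma int_D [CompleteSpace V] {f : ℝ × ℝ → V} (hf : Sm f) (k : Fin 2) : ∫ x in Q2, D k f x = 0 := by
  fin_cases k
  · change ∫ x in Q2, D 0 f x = 0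
    have hc := (hf.D 0).cont
    rw [int_Q2' hc]
    have : ∀ t, ∫ s in (0:ℝ)..1, D 0 f (s, t) = 0 := by
      intro t
      have h : ∀ s ∈ uIcc (0:ℝ) 1, HasDerivAt (fun s => f (s, t)) (D 0 f (s, t)) s := by
        intro s _
        have := line_deriv hf (0, t) (1, 0) s
        simpa [D, ee] using this
      rw [intervalIntegral.integral_eq_sub_of_hasDerivAt h
        ((hc.comp (by fun_prop : Continuous fun s : ℝ => (s, t))).intervalIntegrable _ _)]
      have := hf.1.1 (0, t)
      simp at this
      simp [this]
    simp [this]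
  · change ∫ x in Q2, D 1 f x = 0
    have hc := (hf.D 1).cont
    rw [int_Q2 hc]
    have : ∀ t, ∫ s in (0:ℝ)..1, D 1 f (t, s) = 0 := by
      intro t
      have h : ∀ s ∈ uIcc (0:ℝ) 1, HasDerivAt (fun s => f (t, s)) (D 1 f (t, s)) s := by
        intro s _
        have := line_deriv hf (t, 0) (0, 1) s
        simpa [D, ee] using this
      rw [intervalIntegral.integral_eq_sub_of_hasDerivAt h
        ((hc.comp (by fun_prop : Continuous fun s : ℝ => (t, s))).intervalIntegrable _ _)]
      have := hf.1.2 (t, 0)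
      simp at this
      simp [this]
    simp [this]

end
end

noncomputable section
set_option linter.unusedSectionVars false
open Set Filter Topology ProbabilityTheory
open scoped ContDiff

/-- standard gaussian on the plane -/
def ga : Measure (ℝ × ℝ) := (gaussianReal 0 1).prod (gaussianReal 0 1)

instance : IsProbabilityMeasure ga := by unfold ga; infer_instance

/-- heat extension (time `τ²/2`) -/
def He {V : Type} [NormedAddCommGroup V] [NormedSpace ℝ V] (f : ℝ × ℝ → V) (τ : ℝ) (x : ℝ × ℝ) : V :=
  ∫ y, f (x + τ • y) ∂ga

section
variable {V : Type} [NormedAddCommGroup V] [NormedSpace ℝ V] [CompleteSpace V]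

lemma int_g1 : Integrable (fun y : ℝ => y) (gaussianReal 0 1) :=
  (memLp_id_gaussianReal (μ := 0) (v := 1) 1).integrable (by simp)

lemma int_ga1 : Integrable (fun y : ℝ × ℝ => y.1) ga := int_g1.comp_fst _
lemma int_ga2 : Integrable (fun y : ℝ × ℝ => y.2) ga := int_g1.comp_snd _

lemma int_ganorm : Integrable (fun y : ℝ × ℝ => ‖y‖) ga := by
  have : Integrable (fun y : ℝ × ℝ => y) ga := by
    have := int_ga1.prodMk int_ga2
    exact this
  exact this.norm

lemma Sm.int_ga [SecondCountableTopology V] {f : ℝ × ℝ → V} (hf : Sm f) (x : ℝ × ℝ) (τ : ℝ) :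
    Integrable (fun y => f (x + τ • y)) ga := by
  obtain ⟨C, _, hC⟩ := hf.bound
  refine Integrable.of_bound ?_ C (ae_of_all _ fun y => hC _)
  have := hf.cont
  exact (by fun_prop : Continuous fun y => f (x + τ • y)).aestronglyMeasurable

lemma He_cont [SecondCountableTopology V] {f : ℝ × ℝ → V} (hf : Sm f) : Continuous fun z : ℝ × (ℝ × ℝ) => He f z.1 z.2 := by
  obtain ⟨C, _, hC⟩ := hf.bound
  have := hf.cont
  refine continuous_of_dominated (bound := fun _ => C) (fun z => (hf.int_ga _ _).1) (fun z => ae_of_all _ fun y => hC _)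
    (integrable_const _) (ae_of_all _ fun y => by fun_prop)

lemma He_fderiv {f : ℝ × ℝ → ℝ} (hf : Sm f) (τ : ℝ) (x : ℝ × ℝ) :
    HasFDerivAt (He f τ) (He (fderiv ℝ f) τ x) x := by
  obtain ⟨C, _, hC⟩ := hf.fderiv.bound
  refine hasFDerivAt_integral_of_dominated_of_fderiv_le (F := fun x y => f (x + τ • y))
    (F' := fun x y => fderiv ℝ f (x + τ • y)) (bound := fun _ => C) (s := univ) univ_mem ?_ (hf.int_ga _ _)
    (hf.fderiv.int_ga _ _).1 (ae_of_all _ fun y x _ => hC _) (integrable_const _) (ae_of_all _ fun y x _ => ?_)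
  · exact Eventually.of_forall fun x => (hf.int_ga _ _).1
  · have := (hf.diff (x + τ • y)).hasFDerivAt.comp x ((hasFDerivAt_id x).add_const (τ • y))
    simp only [ContinuousLinearMap.comp_id] at this
    exact this

lemma D_He {f : ℝ × ℝ → ℝ} (hf : Sm f) (τ : ℝ) (k : Fin 2) : D k (He f τ) = He (D k f) τ := by
  funext x
  rw [HasFDerivAt_D (He_fderiv hf τ x), He, ContinuousLinearMap.integral_apply (hf.fderiv.int_ga _ _)]
  rfl

lemma fderiv_decomp (L : ℝ × ℝ →L[ℝ] V) (y : ℝ × ℝ) : L y = y.1 • L (ee 0) + y.2 • L (ee 1) := by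
  rw [← L.map_smul, ← L.map_smul, ← L.map_add]
  congr 1
  ext <;> simp [ee]

lemma contDiff_of_D {C : (ℝ × ℝ → V) → Prop} (h1 : ∀ f, C f → Differentiable ℝ f) (h2 : ∀ f, C f → ∀ k, C (D k f)) 
    (f : ℝ × ℝ → V) (hf : C f) : ContDiff ℝ ∞ f := by
  rw [contDiff_infty]
  intro n
  induction n generalizing f with
  | zero => exact contDiff_zero.2 (h1 f hf).continuous
  | succ n ih =>
    have := contDiff_succ_iff_fderiv_apply (𝕜 := ℝ) (n := n) (f := f)
    refine this.2 ⟨h1 f hf, by simp, fun y => ?_⟩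
    have e : (fun x => fderiv ℝ f x y) = fun x => y.1 • D 0 f x + y.2 • D 1 f x := by
      funext x; exact fderiv_decomp _ _
    rw [e]
    exact ((ih _ (h2 f hf 0)).const_smul _).add ((ih _ (h2 f hf 1)).const_smul _)

lemma Sm.He {f : ℝ × ℝ → ℝ} (hf : Sm f) (τ : ℝ) : Sm (He f τ) := by
  refine ⟨⟨fun x => ?_, fun x => ?_⟩, ?_⟩
  · simp only [_root_.He]
    congr 1; funext y
    rw [← hf.1.1 (x + τ • y)]; congr 1; ext <;> simp; ring
  · simp only [_root_.He]
    congr 1; funext y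
    rw [← hf.1.2 (x + τ • y)]; congr 1; ext <;> simp; ring
  · refine contDiff_of_D (C := fun g => ∃ f, Sm f ∧ g = _root_.He f τ) ?_ ?_ _ ⟨f, hf, rfl⟩
    · rintro _ ⟨f, hf, rfl⟩ x
      exact (He_fderiv hf τ x).differentiableAt
    · rintro _ ⟨f, hf, rfl⟩ k
      exact ⟨_, hf.D k, D_He hf τ k⟩

lemma stein1 {φ φ' : ℝ → ℝ} (h : ∀ t, HasDerivAt φ (φ' t) t) (hc : Continuous φ') {C C' : ℝ} (hC : ∀ t, ‖φ t‖ ≤ C)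
    (hC' : ∀ t, ‖φ' t‖ ≤ C') : ∫ t, φ' t ∂(gaussianReal 0 1) = ∫ t, φ t * t ∂(gaussianReal 0 1) := by
  have hφ : Continuous φ := continuous_iff_continuousAt.2 fun t => (h t).continuousAt
  have i1 : Integrable φ (gaussianReal 0 1) :=
    Integrable.of_bound hφ.aestronglyMeasurable C (ae_of_all _ hC)
  have i2 : Integrable φ' (gaussianReal 0 1) :=
    Integrable.of_bound hc.aestronglyMeasurable C' (ae_of_all _ hC')
  have i3 : Integrable (fun t => φ t * t) (gaussianReal 0 1) :=
    int_g1.bdd_mul (c := C) hφ.aestronglyMeasurable (ae_of_all _ hC)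
  rw [← sub_eq_zero, ← integral_sub i2 i3]
  have key : ∀ g : ℝ → ℝ, Integrable g (gaussianReal 0 1) → Integrable (fun t => gaussianPDFReal 0 1 t * g t) := by
    intro g hg
    rw [gaussianReal_of_var_ne_zero 0 one_ne_zero, integrable_withDensity_iff_integrable_smul₀'] at hg
    · simpa [gaussianPDF, ENNReal.toReal_ofReal (gaussianPDFReal_nonneg _ _ _)] using hg
    · exact (measurable_gaussianPDF 0 1).aemeasurable
    · exact ae_of_all _ fun x => by simp [gaussianPDF]
  rw [integral_gaussianReal_eq_integral_smul one_ne_zero]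
  refine integral_eq_zero_of_hasDerivAt_of_integrable (f := fun t => gaussianPDFReal 0 1 t * φ t) ?_ ?_ ?_
  · intro t
    have hp : HasDerivAt (gaussianPDFReal 0 1) (- t * gaussianPDFReal 0 1 t) t := by
      have e : gaussianPDFReal 0 1 = fun t => (√(2 * π))⁻¹ * rexp (-(t ^ 2) / 2) := by
        funext t; simp [gaussianPDFReal]
      rw [e]
      have : HasDerivAt (fun t : ℝ => -(t ^ 2) / 2) (-t) t := by
        exact (((hasDerivAt_pow 2 t).neg).div_const 2).congr_deriv (by simp; ring)
      exact (this.exp.const_mul ((√(2 * π))⁻¹)).congr_deriv (by ring)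
    exact (hp.mul (h t)).congr_deriv (by simp only [smul_eq_mul]; ring)
  · simpa using key _ (i2.sub i3)
  · exact key _ i1

lemma stein {f : ℝ × ℝ → ℝ} (hf : Sm f) (x : ℝ × ℝ) (τ : ℝ) (k : Fin 2) :
    τ * He (D k f) τ x = ∫ y, f (x + τ • y) * (![y.1, y.2] k) ∂ga := by
  obtain ⟨C, _, hC⟩ := hf.bound
  obtain ⟨C', _, hC'⟩ := (hf.D k).bound
  have hcf := hf.cont
  have hcD := (hf.D k).cont
  rw [He, ← integral_const_mul]
  fin_cases k
  · have i1 : Integrable (fun y => τ * D 0 f (x + τ • y)) ga := ((hf.D 0).int_ga x τ).const_mul τ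
    have i2 : Integrable (fun y => f (x + τ • y) * y.1) ga :=
      int_ga1.bdd_mul (c := C) (hf.int_ga x τ).1 (ae_of_all _ fun y => hC _)
    simp only [Fin.zero_eta, Matrix.cons_val_zero] at hcD hC' ⊢
    unfold ga at i1 i2 ⊢
    rw [integral_prod_symm _ i1, integral_prod_symm _ i2]
    congr 1; funext t
    refine stein1 (φ := fun s => f (x + τ • (s, t))) (C := C) (C' := |τ| * C') ?_ (by fun_prop) (fun s => hC _) ?_
    · intro s
      have h1 := line_deriv hf (x + (0, τ * t)) (τ • ee 0) s
      rw [map_smul, smul_eq_mul] at h1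
      have e : ∀ s : ℝ, x + (0, τ * t) + s • τ • ee 0 = x + τ • (s, t) := by
        intro s; ext <;> simp [ee]; ring
      simp only [e] at h1
      exact h1
    · intro s
      rw [norm_mul, Real.norm_eq_abs]
      exact mul_le_mul_of_nonneg_left (hC' _) (abs_nonneg _)
  · have i1 : Integrable (fun y => τ * D 1 f (x + τ • y)) ga := ((hf.D 1).int_ga x τ).const_mul τ
    have i2 : Integrable (fun y => f (x + τ • y) * y.2) ga :=
      int_ga2.bdd_mul (c := C) (hf.int_ga x τ).1 (ae_of_all _ fun y => hC _)
    simp only [Fin.mk_one, Matrix.cons_val_one] at hcD hC' ⊢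
    unfold ga at i1 i2 ⊢
    refine (integral_prod _ i1).trans (Eq.trans ?_ (integral_prod _ i2).symm)
    congr 1; funext t
    refine stein1 (φ := fun s => f (x + τ • (t, s))) (C := C) (C' := |τ| * C') ?_ (by fun_prop) (fun s => hC _) ?_
    · intro s
      have h1 := line_deriv hf (x + (τ * t, 0)) (τ • ee 1) s
      rw [map_smul, smul_eq_mul] at h1
      have e : ∀ s : ℝ, x + (τ * t, 0) + s • τ • ee 1 = x + τ • (t, s) := by
        intro s; ext <;> simp [ee]; ring
      simp only [e] at h1
      exact h1
    · intro s
      rw [norm_mul, Real.norm_eq_abs]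
      exact mul_le_mul_of_nonneg_left (hC' _) (abs_nonneg _)

lemma He_deriv {f : ℝ × ℝ → ℝ} (hf : Sm f) (x : ℝ × ℝ) (τ : ℝ) :
    HasDerivAt (fun τ => He f τ x) (τ * (He (D 0 (D 0 f)) τ x + He (D 1 (D 1 f)) τ x)) τ := by
  obtain ⟨C, _, hC⟩ := hf.fderiv.bound
  have hcf := hf.cont
  have hcd := hf.fderiv.cont
  have := hasDerivAt_integral_of_dominated_loc_of_deriv_le (μ := ga) (F := fun τ y => f (x + τ • y))
    (F' := fun τ y => fderiv ℝ f (x + τ • y) y) (x₀ := τ) (s := univ) (bound := fun y => C * ‖y‖) univ_mem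
    (Eventually.of_forall fun τ => (hf.int_ga x τ).1) (hf.int_ga x τ)
    (by fun_prop : Continuous fun y => fderiv ℝ f (x + τ • y) y).aestronglyMeasurable
    (ae_of_all _ fun y t _ => (ContinuousLinearMap.le_opNorm _ _).trans
      (mul_le_mul_of_nonneg_right (hC _) (norm_nonneg _))) (int_ganorm.const_mul C)
    (ae_of_all _ fun y t _ => line_deriv hf x y t)
  refine this.2.congr_deriv ?_
  rw [mul_add, stein (hf.D 0), stein (hf.D 1), ← integral_add]
  · congr 1; funext y
    rw [fderiv_decomp]
    simp [D]; ring
  · obtain ⟨C, _, hC⟩ := (hf.D 0).bound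
    exact int_ga1.bdd_mul (c := C) ((hf.D 0).int_ga x τ).1 (ae_of_all _ fun y => hC _)
  · obtain ⟨C, _, hC⟩ := (hf.D 1).bound
    exact int_ga2.bdd_mul (c := C) ((hf.D 1).int_ga x τ).1 (ae_of_all _ fun y => hC _)

lemma He_zero (f : ℝ × ℝ → ℝ) : He f 0 = f := by
  funext x; simp [He]

lemma He_bound {f : ℝ × ℝ → ℝ} {C : ℝ} (hC : ∀ x, |f x| ≤ C) (τ : ℝ) (x : ℝ × ℝ) : |He f τ x| ≤ C := by
  have := norm_integral_le_of_norm_le_const (μ := ga) (f := fun y => f (x + τ • y)) (C := C)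
    (ae_of_all _ fun y => hC _)
  simpa [He] using this

lemma He_D_decay {f : ℝ × ℝ → ℝ} (hf : Sm f) (k : Fin 2) : ∃ C, 0 ≤ C ∧ ∀ τ > 0, ∀ x,
    |He (D k f) τ x| ≤ C / τ := by
  obtain ⟨C, hC0, hC⟩ := hf.bound
  refine ⟨C * ∫ y, ‖y‖ ∂ga, mul_nonneg hC0 (integral_nonneg fun _ => norm_nonneg _), fun τ hτ x => ?_⟩
  rw [le_div_iff₀ hτ, mul_comm, ← abs_of_pos hτ, ← abs_mul, abs_of_pos hτ, stein hf, ← integral_const_mul]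
  rw [← Real.norm_eq_abs]
  refine norm_integral_le_of_norm_le (int_ganorm.const_mul C) (ae_of_all _ fun y => ?_)
  rw [norm_mul]
  refine mul_le_mul (hC _) ?_ (norm_nonneg _) hC0
  fin_cases k
  · exact norm_fst_le y
  · exact norm_snd_le y

lemma He_pos {u : ℝ × ℝ → ℝ} (hu : Sm u) (h0 : ∀ x, 0 < u x) (τ : ℝ) (x : ℝ × ℝ) : 0 < He u τ x := by
  rw [He, integral_pos_iff_support_of_nonneg (fun y => (h0 _).le) (hu.int_ga x τ)]
  have : Function.support (fun y => u (x + τ • y)) = univ := by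
    ext y; simp [(h0 _).ne']
  simp [this]

lemma He_jensen {f u : ℝ × ℝ → ℝ} (hf : Sm f) (hu : Sm u) (h0 : ∀ x, 0 < u x) {θ : ℝ} (hθ : 0 ≤ θ) (hθ1 : θ ≤ 1)
    (h : ∀ x, |f x| ≤ u x ^ θ) (τ : ℝ) (x : ℝ × ℝ) : |He f τ x| ≤ He u τ x ^ θ := by
  have hp : Sm (pw θ u) := hu.pw θ h0
  calc |He f τ x| ≤ ∫ y, |f (x + τ • y)| ∂ga := abs_integral_le_integral_abs
    _ ≤ ∫ y, pw θ u (x + τ • y) ∂ga :=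
        integral_mono (hf.int_ga x τ).abs (hp.int_ga x τ) (fun y => h _)
    _ ≤ _ := by
        have := (Real.concaveOn_rpow hθ hθ1).le_map_integral (μ := ga) (f := fun y => u (x + τ • y))
          (continuousOn_id.rpow_const (fun _ _ => Or.inr hθ)) isClosed_Ici (ae_of_all _ fun y => (h0 _).le)
          (hu.int_ga x τ) (hp.int_ga x τ)
        exact this
end
end

noncomputable section
set_option linter.unusedSectionVars false
open Set Filter Topology ProbabilityTheory
open scoped ContDiff

/-- space-time integral -/
def J (T : ℝ) (Θ : ℝ × (ℝ × ℝ) → ℝ) : ℝ := ∫ z in Ioc 0 T ×ˢ Q2, Θ z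

lemma J_int (T : ℝ) {Θ : ℝ × (ℝ × ℝ) → ℝ} (h : Continuous Θ) : IntegrableOn Θ (Ioc 0 T ×ˢ Q2) :=
  (h.continuousOn.integrableOn_compact (isCompact_Icc.prod (isCompact_Icc.prod isCompact_Icc))).mono_set
    (prod_mono Ioc_subset_Icc_self Q2_sub)

lemma J_mono {T : ℝ} {Θ Θ' : ℝ × (ℝ × ℝ) → ℝ} (h : Continuous Θ) (h' : Continuous Θ')
    (hle : ∀ z, 0 ≤ z.1 → Θ z ≤ Θ' z) : J T Θ ≤ J T Θ' :=
  setIntegral_mono_on (J_int T h) (J_int T h') (measurableSet_Ioc.prod Q2_meas) fun z hz => hle z hz.1.1.le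

lemma J_add {T : ℝ} {Θ Θ' : ℝ × (ℝ × ℝ) → ℝ} (h : Continuous Θ) (h' : Continuous Θ') :
    J T (fun z => Θ z + Θ' z) = J T Θ + J T Θ' := integral_add (J_int T h) (J_int T h')

lemma J_const {T : ℝ} {Θ : ℝ × (ℝ × ℝ) → ℝ} (c : ℝ) : J T (fun z => c * Θ z) = c * J T Θ :=
  integral_const_mul _ _

lemma J_abs {T : ℝ} {Θ : ℝ × (ℝ × ℝ) → ℝ} : |J T Θ| ≤ J T (fun z => |Θ z|) := abs_integral_le_integral_abs

lemma J_slice {T : ℝ} {Θ : ℝ × (ℝ × ℝ) → ℝ} (h : Continuous Θ) :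
    J T Θ = ∫ τ in Ioc 0 T, ∫ x in Q2, Θ (τ, x) := by
  rw [J, Measure.volume_eq_prod]
  exact setIntegral_prod _ (J_int T h)

lemma J_congr {T : ℝ} {Θ Θ' : ℝ × (ℝ × ℝ) → ℝ} (h : Continuous Θ) (h' : Continuous Θ')
    (he : ∀ τ, ∫ x in Q2, Θ (τ, x) = ∫ x in Q2, Θ' (τ, x)) : J T Θ = J T Θ' := by
  rw [J_slice h, J_slice h']; simp_rw [he]

lemma J_ftc {T : ℝ} (hT : 0 ≤ T) {Ψ ψ : ℝ → ℝ × ℝ → ℝ} (h : Continuous fun z : ℝ × (ℝ × ℝ) => ψ z.1 z.2)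
    (hΨ : ∀ τ, Continuous (Ψ τ))
    (hd : ∀ x τ, HasDerivAt (fun τ => Ψ τ x) (ψ τ x) τ) :
    J T (fun z => ψ z.1 z.2) = (∫ x in Q2, Ψ T x) - ∫ x in Q2, Ψ 0 x := by
  rw [J, Measure.volume_eq_prod, ← setIntegral_prod_swap, setIntegral_prod]
  · rw [← integral_sub (intOn (hΨ T)) (intOn (hΨ 0))]
    congr 1; funext x
    rw [← intervalIntegral.integral_eq_sub_of_hasDerivAt (f := fun τ => Ψ τ x) (f' := fun τ => ψ τ x)
      (fun τ _ => hd x τ), intervalIntegral.integral_of_le hT]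
    · rfl
    · have : Continuous fun τ => ψ τ x := h.comp (by fun_prop : Continuous fun τ : ℝ => (τ, x))
      exact this.intervalIntegrable _ _
  · refine ((h.comp continuous_swap).continuousOn.integrableOn_compact
      ((isCompact_Icc.prod isCompact_Icc).prod isCompact_Icc)).mono_set
      (prod_mono Q2_sub Ioc_subset_Icc_self)

lemma hess_ineq {c s K F U Fa Ua : ℝ} (hU : 0 < U) {α : ℝ} (hc : c = s * (1 - 2 * α))
    (hF : |F| ≤ U ^ (s * α)) (hK : K * (s * (s - 1)) = 4 * c ^ 2 + |c * (c - 1)|) :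
    U ^ c * Fa ^ 2 ≤ 2 * U ^ c * Fa ^ 2 + 4 * c * F * U ^ (c - 1) * Fa * Ua
      + c * (c - 1) * F ^ 2 * U ^ (c - 2) * Ua ^ 2 + K * s * (s - 1) * U ^ (s - 2) * Ua ^ 2 := by
  have hF2 : F ^ 2 * U ^ (c - 2) ≤ U ^ (s - 2) := by
    have : F ^ 2 ≤ U ^ (2 * (s * α)) := by
      rw [← sq_abs, two_mul, rpow_add hU, ← sq]
      exact pow_le_pow_left₀ (abs_nonneg _) hF 2
    calc F ^ 2 * U ^ (c - 2) ≤ U ^ (2 * (s * α)) * U ^ (c - 2) :=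
          mul_le_mul_of_nonneg_right this (rpow_nonneg hU.le _)
      _ = U ^ (s - 2) := by rw [← rpow_add hU]; congr 1; rw [hc]; ring
  have e1 : U ^ (c - 1) = U ^ c / U := by rw [rpow_sub hU, rpow_one]
  have e2 : U ^ (c - 2) = U ^ c / U ^ 2 := by rw [rpow_sub hU]; norm_num
  have hUc := rpow_pos_of_pos hU c
  have q1 : 0 ≤ U ^ c * (Fa + 2 * c * F * Ua / U) ^ 2 := by positivity
  have q2 : U ^ c * (Fa + 2 * c * F * Ua / U) ^ 2 = U ^ c * Fa ^ 2 + 4 * c * F * U ^ (c - 1) * Fa * Ua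
      + 4 * c ^ 2 * (F ^ 2 * U ^ (c - 2)) * Ua ^ 2 := by
    rw [e1, e2]; field_simp; ring
  have h3 : (4 * c ^ 2 - c * (c - 1)) * (F ^ 2 * U ^ (c - 2)) ≤ (4 * c ^ 2 + |c * (c - 1)|) * U ^ (s - 2) := by
    have p : 0 ≤ F ^ 2 * U ^ (c - 2) := by positivity
    calc _ ≤ (4 * c ^ 2 + |c * (c - 1)|) * (F ^ 2 * U ^ (c - 2)) := by
          apply mul_le_mul_of_nonneg_right _ p
          linarith [neg_abs_le (c * (c - 1))]
      _ ≤ _ := mul_le_mul_of_nonneg_left hF2 (by positivity)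
  have h4 := mul_le_mul_of_nonneg_right h3 (sq_nonneg Ua)
  rw [← hK] at h4
  nlinarith [h4, q1, q2]

lemma sq_est {s α : ℝ} (hs : 1 < s) (hα : 0 ≤ α) (hsα : s * α ≤ 1) : ∃ K, 0 ≤ K ∧ ∀ f u : ℝ × ℝ → ℝ,
    Sm f → Sm u → (∀ x, 0 < u x) → (∀ x, |f x| ≤ u x ^ (s * α)) → ∀ T, 0 ≤ T → ∀ k,
    J T (fun z => z.1 * (He u z.1 z.2 ^ (s * (1 - 2 * α)) * He (D k f) z.1 z.2 ^ 2)) ≤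
      K * ∫ x in Q2, u x ^ s := by
  set c := s * (1 - 2 * α) with hc
  have hss : 0 < s * (s - 1) := mul_pos (by linarith) (by linarith)
  set K := (4 * c ^ 2 + |c * (c - 1)|) / (s * (s - 1)) with hK
  have hK' : K * (s * (s - 1)) = 4 * c ^ 2 + |c * (c - 1)| := by
    rw [hK]; exact div_mul_cancel₀ _ hss.ne'
  have hK0 : 0 ≤ K := by positivity
  refine ⟨1 + K, by positivity, fun f u hf hu h0 hfu T hT k => ?_⟩
  have hU : ∀ τ x, 0 < He u τ x := He_pos hu h0
  have hF : ∀ τ x, |He f τ x| ≤ He u τ x ^ (s * α) :=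
    He_jensen hf hu h0 (mul_nonneg (by linarith) hα) hsα hfu
  let Ψ : ℝ → ℝ × ℝ → ℝ := fun τ x => He f τ x ^ 2 * He u τ x ^ c + K * He u τ x ^ s
  let A : ℝ → ℝ × ℝ → ℝ := fun τ x => 2 * He f τ x * He u τ x ^ c
  let B : ℝ → ℝ × ℝ → ℝ := fun τ x => c * He f τ x ^ 2 * He u τ x ^ (c - 1) + K * s * He u τ x ^ (s - 1)
  let ψ : ℝ → ℝ × ℝ → ℝ := fun τ x => τ * (A τ x * (He (D 0 (D 0 f)) τ x + He (D 1 (D 1 f)) τ x)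
    + B τ x * (He (D 0 (D 0 u)) τ x + He (D 1 (D 1 u)) τ x))
  let H : Fin 2 → ℝ → ℝ × ℝ → ℝ := fun a τ x =>
    2 * He u τ x ^ c * He (D a f) τ x ^ 2 + 4 * c * He f τ x * He u τ x ^ (c - 1) * He (D a f) τ x * He (D a u) τ x
      + c * (c - 1) * He f τ x ^ 2 * He u τ x ^ (c - 2) * He (D a u) τ x ^ 2
      + K * s * (s - 1) * He u τ x ^ (s - 2) * He (D a u) τ x ^ 2
  have cf := He_cont hf
  have cu := He_cont hu
  have cup : ∀ c : ℝ, Continuous fun z : ℝ × (ℝ × ℝ) => He u z.1 z.2 ^ c := fun c =>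
    cu.rpow_const fun z => Or.inl (hU _ _).ne'
  have cf1 := fun a => He_cont (hf.D a)
  have cu1 := fun a => He_cont (hu.D a)
  have cf2 := fun a => He_cont ((hf.D a).D a)
  have cu2 := fun a => He_cont ((hu.D a).D a)
  have cψ : Continuous fun z : ℝ × (ℝ × ℝ) => ψ z.1 z.2 := by
    have := cup c; have := cup (c - 1); have := cup (s - 1)
    have := cf2 0; have := cf2 1; have := cu2 0; have := cu2 1
    simp only [ψ, A, B]
    fun_prop
  have cH : ∀ a, Continuous fun z : ℝ × (ℝ × ℝ) => H a z.1 z.2 := by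
    intro a
    have := cup c; have := cup (c - 1); have := cup (s - 2); have := cup (c - 2)
    have := cf1 a; have := cu1 a
    simp only [H]
    fun_prop
  have cΨ : ∀ τ, Continuous (Ψ τ) := by
    intro τ
    have h1 := (hf.He τ).cont
    have h2 : Continuous fun x => He u τ x ^ c := ((hu.He τ).pw c (hU τ)).cont
    have h3 : Continuous fun x => He u τ x ^ s := ((hu.He τ).pw s (hU τ)).cont
    simp only [Ψ]
    fun_prop
  have hd : ∀ x τ, HasDerivAt (fun τ => Ψ τ x) (ψ τ x) τ := by
    intro x τ
    have d1 := He_deriv hf x τ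
    have d2 := He_deriv hu x τ
    have d3 := d2.rpow_const (p := c) (Or.inl (hU τ x).ne')
    have d4 := d2.rpow_const (p := s) (Or.inl (hU τ x).ne')
    refine (((d1.pow 2).mul d3).add (d4.const_mul K)).congr_deriv ?_
    simp only [ψ, A, B]
    simp
    ring
  have main : J T (fun z => ψ z.1 z.2) = J T (fun z => -(z.1 * (H 0 z.1 z.2 + H 1 z.1 z.2))) := by
    have cH0 := cH 0
    have cH1 := cH 1
    refine J_congr cψ (by fun_prop) fun τ => ?_
    -- divergence
    let G : Fin 2 → ℝ × ℝ → ℝ := fun a =>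
      (2 : ℝ) • (He f τ * pw c (He u τ) * He (D a f) τ) + (c • (He f τ * He f τ * pw (c - 1) (He u τ))
        + (K * s) • pw (s - 1) (He u τ)) * He (D a u) τ
    have sF := hf.He τ
    have sU := hu.He τ
    have sp := fun c => sU.pw c (hU τ)
    have sFa := fun a => (hf.D a).He τ
    have sUa := fun a => (hu.D a).He τ
    have sG1 : ∀ a, Sm (He f τ * pw c (He u τ) * He (D a f) τ) := fun a => (sF.mul (sp c)).mul (sFa a)
    have sG2 := ((sF.mul sF).mul (sp (c - 1)))
    have sG3 := (sG2.smul c).add ((sp (s-1)).smul (K * s))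
    have sG : ∀ a, Sm (G a) := fun a => ((sG1 a).smul 2).add (sG3.mul (sUa a))
    have hG : ∀ a x, D a (G a) x = A τ x * He (D a (D a f)) τ x + B τ x * He (D a (D a u)) τ x + H a τ x := by
      intro a x
      simp only [G, A, B, H]
      rw [D_add a ((sG1 a).smul 2) (sG3.mul (sUa a)), D_smul a _ (sG1 a), D_mul a (sF.mul (sp c)) (sFa a),
        D_mul a sF (sp c), D_mul a sG3 (sUa a), D_add a (sG2.smul c) ((sp (s-1)).smul (K * s)),
        D_smul a _ sG2, D_smul a _ (sp (s-1)), D_mul a (sF.mul sF) (sp (c-1)), D_mul a sF sF,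
        D_pw a c sU (hU τ), D_pw a (c - 1) sU (hU τ), D_pw a (s - 1) sU (hU τ), D_He hf, D_He hu, D_He (hf.D a), D_He (hu.D a)]
      have e1 : c - 1 - 1 = c - 2 := by ring
      have e2 : s - 1 - 1 = s - 2 := by ring
      simp only [Pi.add_apply, Pi.mul_apply, Pi.smul_apply, smul_eq_mul, pw, e1, e2]
      ring
    have z0 := int_D (sG 0) 0
    have z1 := int_D (sG 1) 1
    rw [← sub_eq_zero, ← integral_sub]
    · have : ∀ x, ψ τ x - -(τ * (H 0 τ x + H 1 τ x)) = τ * (D 0 (G 0) x + D 1 (G 1) x) := by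
        intro x; rw [hG, hG]; simp only [ψ]; ring
      simp only [this]
      rw [integral_const_mul, integral_add (intOn ((sG 0).D 0).cont) (intOn ((sG 1).D 1).cont), z0, z1]
      simp
    · exact intOn (cψ.comp (by fun_prop : Continuous fun x : ℝ × ℝ => (τ, x)))
    · exact intOn ((by fun_prop : Continuous fun z : ℝ × (ℝ × ℝ) => -(z.1 * (H 0 z.1 z.2 + H 1 z.1 z.2))).comp (by fun_prop : Continuous fun x : ℝ × ℝ => (τ, x)))
  have ftc := J_ftc hT cψ cΨ hd
  have cH0 := cH 0
  have cH1 := cH 1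
  have neg : J T (fun z => -(z.1 * (H 0 z.1 z.2 + H 1 z.1 z.2))) = - J T (fun z => (z.1 * (H 0 z.1 z.2 + H 1 z.1 z.2))) :=
    integral_neg _
  have hH : ∀ a τ x, He u τ x ^ c * He (D a f) τ x ^ 2 ≤ H a τ x := fun a τ x =>
    hess_ineq (hU τ x) hc (hF τ x) hK'
  have hHn : ∀ a τ x, 0 ≤ H a τ x := fun a τ x => le_trans
    (mul_nonneg (rpow_nonneg (hU τ x).le _) (sq_nonneg _)) (hH a τ x)
  have le1 : J T (fun z => z.1 * (He u z.1 z.2 ^ c * He (D k f) z.1 z.2 ^ 2)) ≤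
      J T (fun z => (z.1 * (H 0 z.1 z.2 + H 1 z.1 z.2))) := by
    refine J_mono ?_ (by fun_prop) fun z hz => mul_le_mul_of_nonneg_left ?_ hz
    · have := cup c; have := cf1 k
      fun_prop
    · refine (hH k _ _).trans ?_
      fin_cases k
      · simpa using hHn 1 z.1 z.2
      · simpa using hHn 0 z.1 z.2
  have hT0 : 0 ≤ ∫ x in Q2, Ψ T x := integral_nonneg fun x => by
    have := (hU T x).le
    simp only [Ψ]; positivity
  have h00 : ∫ x in Q2, Ψ 0 x ≤ (1 + K) * ∫ x in Q2, u x ^ s := by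
    rw [← integral_const_mul]
    refine setIntegral_mono (intOn (cΨ 0)) (intOn (((hu.pw s h0).cont).const_smul (1 + K))) fun x => ?_
    simp only [Ψ, He_zero]
    have : f x ^ 2 ≤ u x ^ (2 * (s * α)) := by
      rw [← sq_abs, two_mul, rpow_add (h0 x), ← sq]
      exact pow_le_pow_left₀ (abs_nonneg _) (hfu x) 2
    have : f x ^ 2 * u x ^ c ≤ u x ^ s := by
      calc f x ^ 2 * u x ^ c ≤ u x ^ (2 * (s * α)) * u x ^ c :=
            mul_le_mul_of_nonneg_right this (rpow_nonneg (h0 x).le _)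
        _ = u x ^ s := by rw [← rpow_add (h0 x)]; congr 1; rw [hc]; ring
    linarith
  linarith
end

noncomputable section
set_option linter.unusedSectionVars false
open Set Filter Topology ProbabilityTheory
open scoped ContDiff

lemma tri_core {s α β γ : ℝ} (hs : 1 < s) (hα : 0 ≤ α) (hβ : 0 ≤ β) (hγ : 0 ≤ γ) (hsum : α + β + γ = 1)
    (hsα : s * α ≤ 1) (hsβ : s * β ≤ 1) (hsγ : s * γ ≤ 1) : ∃ K, 0 ≤ K ∧ ∀ f g h u : ℝ × ℝ → ℝ,
    Sm f → Sm g → Sm h → Sm u → (∀ x, 0 < u x) → (∀ x, |f x| ≤ u x ^ (s * α)) →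
    (∀ x, |g x| ≤ u x ^ (s * β)) → (∀ x, |h x| ≤ u x ^ (s * γ)) → ∀ T, 0 ≤ T → ∀ k l,
    J T (fun z => z.1 * (|He h z.1 z.2| * |He (D k f) z.1 z.2| * |He (D l g) z.1 z.2|)) ≤
      K * ∫ x in Q2, u x ^ s := by
  obtain ⟨K1, hK1, H1⟩ := sq_est hs hα hsα
  obtain ⟨K2, hK2, H2⟩ := sq_est hs hβ hsβ
  refine ⟨K1 + K2, by positivity, fun f g h u hf hg hh hu h0 hfu hgu hhu T hT k l => ?_⟩
  have hU := He_pos hu h0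
  have e1 := H1 f u hf hu h0 hfu T hT k
  have e2 := H2 g u hg hu h0 hgu T hT l
  have hH := He_jensen hh hu h0 (mul_nonneg (by linarith) hγ) hsγ hhu
  have cu := He_cont hu
  have cup : ∀ c : ℝ, Continuous fun z : ℝ × (ℝ × ℝ) => He u z.1 z.2 ^ c := fun c =>
    cu.rpow_const fun z => Or.inl (hU _ _).ne'
  have c1 := He_cont (hf.D k)
  have c2 := He_cont (hg.D l)
  have c3 := He_cont hh
  have c4 := cup (s * (1 - 2 * α))
  have c5 := cup (s * (1 - 2 * β))
  rw [add_mul]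
  refine le_trans ?_ (add_le_add e1 e2)
  rw [← J_add (by fun_prop) (by fun_prop)]
  refine J_mono (by fun_prop) (by fun_prop) fun z hz => ?_
  rw [← mul_add]
  refine mul_le_mul_of_nonneg_left ?_ hz
  set U := He u z.1 z.2 with hUd
  have hU0 : 0 < U := hU _ _
  set X := He (D k f) z.1 z.2
  set Y := He (D l g) z.1 z.2
  have a1 : U ^ (s * (1 - 2 * α)) = (U ^ (s * (1/2 - α))) ^ 2 := by
    rw [sq, ← rpow_add hU0]; congr 1; ring
  have a2 : U ^ (s * (1 - 2 * β)) = (U ^ (s * (1/2 - β))) ^ 2 := by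
    rw [sq, ← rpow_add hU0]; congr 1; ring
  have a3 : U ^ (s * γ) = U ^ (s * (1/2 - α)) * U ^ (s * (1/2 - β)) := by
    rw [← rpow_add hU0]; congr 1
    have : γ = 1 - α - β := by linarith
    rw [this]; ring
  have b := hH z.1 z.2
  rw [← hUd, a3] at b
  rw [a1, a2]
  set P := U ^ (s * (1/2 - α))
  set Q := U ^ (s * (1/2 - β))
  have hP : 0 ≤ P := rpow_nonneg hU0.le _
  have hQ : 0 ≤ Q := rpow_nonneg hU0.le _
  calc _ ≤ P * Q * |X| * |Y| := by gcongr
    _ ≤ _ := by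
      rw [← sq_abs X, ← sq_abs Y]
      nlinarith [sq_nonneg (P * |X| - Q * |Y|), sq_nonneg (P * |X|), sq_nonneg (Q * |Y|)]

/-- smooth majorant of `|f|^p` -/
def maj (p : ℝ) (f : ℝ × ℝ → ℝ) : ℝ × ℝ → ℝ := pw (p / 2) ((fun _ => 1) + f * f)

lemma maj_sm (p : ℝ) {f : ℝ × ℝ → ℝ} (hf : Sm f) : Sm (maj p f) :=
  ((Sm.const 1).add (hf.mul hf)).pw _ fun x => by simp; nlinarith [mul_self_nonneg (f x)]

lemma maj_pos (p : ℝ) (f : ℝ × ℝ → ℝ) (x : ℝ × ℝ) : 0 < maj p f x := by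
  simp only [maj, pw]
  apply rpow_pos_of_pos
  simp; nlinarith [mul_self_nonneg (f x)]

lemma maj_ge {p : ℝ} (hp : 0 < p) (f : ℝ × ℝ → ℝ) (x : ℝ × ℝ) : |f x| ^ p ≤ maj p f x := by
  simp only [maj, pw]
  have : |f x| ^ p = (f x * f x) ^ (p / 2) := by
    rw [← abs_mul_abs_self, ← sq, ← rpow_natCast, ← rpow_mul (abs_nonneg _)]
    congr 1; push_cast; ring
  rw [this]
  apply rpow_le_rpow (mul_self_nonneg _) _ (by positivity)
  simp

lemma maj_le {p : ℝ} (hp : 0 < p) (f : ℝ × ℝ → ℝ) (x : ℝ × ℝ) : maj p f x ≤ 2 ^ p * (1 + |f x| ^ p) := by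
  simp only [maj, pw, Pi.add_apply, Pi.mul_apply]
  have h1 : 1 + f x * f x ≤ (1 + |f x|) ^ 2 := by nlinarith [abs_nonneg (f x), abs_mul_abs_self (f x)]
  have h2 : (1 + f x * f x) ^ (p / 2) ≤ (1 + |f x|) ^ p := by
    calc _ ≤ ((1 + |f x|) ^ 2) ^ (p / 2) := rpow_le_rpow (by nlinarith [mul_self_nonneg (f x)]) h1 (by positivity)
      _ = _ := by
        rw [← rpow_natCast, ← rpow_mul (by positivity)]
        congr 1; push_cast; ring
  refine h2.trans ?_
  have hn := rpow_nonneg (abs_nonneg (f x)) p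
  have h2p : (0:ℝ) < 2 ^ p := by positivity
  rcases le_total 1 |f x| with h | h
  · calc (1 + |f x|) ^ p ≤ (2 * |f x|) ^ p := rpow_le_rpow (by positivity) (by linarith) hp.le
      _ = 2 ^ p * |f x| ^ p := mul_rpow (by norm_num) (abs_nonneg _)
      _ ≤ _ := by nlinarith
  · calc (1 + |f x|) ^ p ≤ 2 ^ p := rpow_le_rpow (by positivity) (by linarith) hp.le
      _ ≤ _ := by nlinarith

lemma cont_abs_rpow {p : ℝ} (hp : 0 < p) {f : ℝ × ℝ → ℝ} (hf : Continuous f) : Continuous fun x => |f x| ^ p :=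
  hf.abs.rpow_const fun _ => Or.inr hp.le

lemma maj_int {p : ℝ} (hp : 0 < p) {f : ℝ × ℝ → ℝ} (hf : Sm f) (h : ∫ x in Q2, |f x| ^ p ≤ 1) :
    ∫ x in Q2, maj p f x ≤ 2 ^ p * 2 := by
  have c1 := cont_abs_rpow hp hf.cont
  calc _ ≤ ∫ x in Q2, 2 ^ p * (1 + |f x| ^ p) :=
        setIntegral_mono (intOn (maj_sm p hf).cont) (intOn (by fun_prop)) fun x => maj_le hp f x
    _ = 2 ^ p * (1 + ∫ x in Q2, |f x| ^ p) := by
        rw [integral_const_mul, integral_add (integrable_const _) (intOn c1)]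
        simp
    _ ≤ _ := by gcongr; linarith

lemma He_smul (c : ℝ) (f : ℝ × ℝ → ℝ) (τ : ℝ) (x : ℝ × ℝ) : He (c • f) τ x = c * He f τ x := by
  simp only [He, Pi.smul_apply, smul_eq_mul]
  exact integral_const_mul _ _

lemma scale_int {p A : ℝ} (hA : 0 < A) {f : ℝ × ℝ → ℝ} (h : ∫ x in Q2, |f x| ^ p ≤ A ^ p) :
    ∫ x in Q2, |(A⁻¹ • f) x| ^ p ≤ 1 := by
  have : ∀ x, |(A⁻¹ • f) x| ^ p = (A ^ p)⁻¹ * |f x| ^ p := by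
    intro x
    rw [Pi.smul_apply, smul_eq_mul, abs_mul, mul_rpow (abs_nonneg _) (abs_nonneg _), abs_of_pos (inv_pos.2 hA), inv_rpow hA.le]
  simp only [this]
  rw [integral_const_mul, inv_mul_le_iff₀ (rpow_pos_of_pos hA p)]
  simpa using h

lemma root_bound {p s : ℝ} (hp : 0 < p) (hs : 0 < s) {f : ℝ × ℝ → ℝ} {x : ℝ × ℝ} {w : ℝ} (h : maj p f x ≤ w) :
    |f x| ≤ (w ^ (1 / s)) ^ (s * (1 / p)) := by
  have hw : 0 ≤ w := (maj_pos p f x).le.trans h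
  rw [← rpow_mul hw, show 1 / s * (s * (1 / p)) = 1 / p by field_simp]
  calc |f x| = (|f x| ^ p) ^ (1 / p) := by
        rw [← rpow_mul (abs_nonneg _), mul_one_div_cancel hp.ne', rpow_one]
    _ ≤ _ := rpow_le_rpow (by positivity) ((maj_ge hp f x).trans h) (by positivity)

lemma TL {p q r : ℝ} (hp : 1 < p) (hq : 1 < q) (hr : 1 < r) (h : 1 / p + 1 / q + 1 / r = 1) :
    ∃ C, 0 ≤ C ∧ ∀ f g h : ℝ × ℝ → ℝ, Sm f → Sm g → Sm h → ∀ A B E, 0 < A → 0 < B → 0 < E →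
    ∫ x in Q2, |f x| ^ p ≤ A ^ p → ∫ x in Q2, |g x| ^ q ≤ B ^ q → ∫ x in Q2, |h x| ^ r ≤ E ^ r →
    ∀ T, 0 ≤ T → ∀ k l,
    J T (fun z => z.1 * (|He h z.1 z.2| * |He (D k f) z.1 z.2| * |He (D l g) z.1 z.2|)) ≤ C * (A * B * E) := by
  set s := min p (min q r)
  have hs : 1 < s := lt_min hp (lt_min hq hr)
  have sp : s * (1 / p) ≤ 1 := by
    rw [mul_one_div, div_le_one (by linarith)]; exact min_le_left _ _
  have sq : s * (1 / q) ≤ 1 := by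
    rw [mul_one_div, div_le_one (by linarith)]; exact (min_le_right _ _).trans (min_le_left _ _)
  have sr : s * (1 / r) ≤ 1 := by
    rw [mul_one_div, div_le_one (by linarith)]; exact (min_le_right _ _).trans (min_le_right _ _)
  obtain ⟨K, hK, H⟩ := tri_core hs (α := 1/p) (β := 1/q) (γ := 1/r) (by positivity) (by positivity) (by positivity) h sp sq sr
  refine ⟨K * (2 ^ p * 2 + 2 ^ q * 2 + 2 ^ r * 2), by positivity, ?_⟩
  intro f g h hf hg hh A B E hA hB hE iA iB iE T hT k l
  have sf := hf.smul A⁻¹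
  have sg := hg.smul B⁻¹
  have sh := hh.smul E⁻¹
  have jA := maj_int (by linarith) sf (scale_int hA iA)
  have jB := maj_int (by linarith) sg (scale_int hB iB)
  have jE := maj_int (by linarith) sh (scale_int hE iE)
  set f' := A⁻¹ • f with hf'
  set g' := B⁻¹ • g with hg'
  set h' := E⁻¹ • h with hh'
  have pf := maj_pos p f'
  have pg := maj_pos q g'
  have ph := maj_pos r h'
  have mf := maj_sm p sf
  have mg := maj_sm q sg
  have mh := maj_sm r sh
  set w := maj p f' + maj q g' + maj r h' with hw
  have wpos : ∀ x, 0 < w x := fun x => by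
    have := pf x; have := pg x; have := ph x
    simp only [hw, Pi.add_apply]; positivity
  have sw : Sm w := (mf.add mg).add mh
  have key := H f' g' h' (pw (1 / s) w) sf sg sh (sw.pw _ wpos) (fun x => rpow_pos_of_pos (wpos x) _)
    (fun x => root_bound (by linarith) (by linarith) (by
      have := pf x; have := pg x; have := ph x
      simp only [hw, Pi.add_apply]; linarith))
    (fun x => root_bound (by linarith) (by linarith) (by
      have := pf x; have := pg x; have := ph x
      simp only [hw, Pi.add_apply]; linarith))
    (fun x => root_bound (by linarith) (by linarith) (by
      have := pf x; have := pg x; have := ph x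
      simp only [hw, Pi.add_apply]; linarith)) T hT k l
  have e : ∀ x, pw (1 / s) w x ^ s = maj p f' x + maj q g' x + maj r h' x := by
    intro x
    rw [pw, ← rpow_mul (wpos x).le, one_div_mul_cancel (by linarith), rpow_one]; rfl
  simp only [e] at key
  have e0 : ∫ x in Q2, (maj p f' x + maj q g' x + maj r h' x) = (∫ x in Q2, maj p f' x) + (∫ x in Q2, maj q g' x) + ∫ x in Q2, maj r h' x := by
    refine (integral_add (f := fun x => maj p f' x + maj q g' x) ((intOn mf.cont).add (intOn mg.cont)) (intOn mh.cont)).trans ?_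
    congr 1
    exact integral_add (intOn mf.cont) (intOn mg.cont)
  rw [e0] at key
  have e2 : ∀ z : ℝ × (ℝ × ℝ), z.1 * (|He h z.1 z.2| * |He (D k f) z.1 z.2| * |He (D l g) z.1 z.2|) =
     (A * B * E) * (z.1 * (|He h' z.1 z.2| * |He (D k f') z.1 z.2| * |He (D l g') z.1 z.2|)) := by
    intro z
    rw [hf', hg', hh', D_smul k _ hf, D_smul l _ hg, He_smul, He_smul, He_smul]
    simp only [abs_mul, abs_of_pos (inv_pos.2 hA), abs_of_pos (inv_pos.2 hB), abs_of_pos (inv_pos.2 hE)]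
    field_simp
  simp only [e2]
  rw [J_const, mul_comm]
  refine mul_le_mul_of_nonneg_right (key.trans ?_) (by positivity)
  gcongr

lemma BL {p q : ℝ} (hp : 1 < p) (hq : 1 < q) (h : 1 / p + 1 / q = 1) :
    ∃ C, 0 ≤ C ∧ ∀ f g : ℝ × ℝ → ℝ, Sm f → Sm g → ∀ A B, 0 < A → 0 < B →
    ∫ x in Q2, |f x| ^ p ≤ A ^ p → ∫ x in Q2, |g x| ^ q ≤ B ^ q →
    ∀ T, 0 ≤ T → ∀ k l,
    J T (fun z => z.1 * (|He (D k f) z.1 z.2| * |He (D l g) z.1 z.2|)) ≤ C * (A * B) := by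
  set s := min p q
  have hs : 1 < s := lt_min hp hq
  have sp : s * (1 / p) ≤ 1 := by
    rw [mul_one_div, div_le_one (by linarith)]; exact min_le_left _ _
  have sq : s * (1 / q) ≤ 1 := by
    rw [mul_one_div, div_le_one (by linarith)]; exact min_le_right _ _
  obtain ⟨K, hK, H⟩ := tri_core hs (α := 1/p) (β := 1/q) (γ := 0) (by positivity) (by positivity) le_rfl (by linarith) sp sq (by simp)
  refine ⟨K * (2 ^ p * 2 + 2 ^ q * 2), by positivity, ?_⟩
  intro f g hf hg A B hA hB iA iB T hT k l
  have sf := hf.smul A⁻¹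
  have sg := hg.smul B⁻¹
  have jA := maj_int (by linarith) sf (scale_int hA iA)
  have jB := maj_int (by linarith) sg (scale_int hB iB)
  set f' := A⁻¹ • f with hf'
  set g' := B⁻¹ • g with hg'
  have pf := maj_pos p f'
  have pg := maj_pos q g'
  have mf := maj_sm p sf
  have mg := maj_sm q sg
  set w := maj p f' + maj q g' with hw
  have wpos : ∀ x, 0 < w x := fun x => by
    have := pf x; have := pg x
    simp only [hw, Pi.add_apply]; positivity
  have sw : Sm w := mf.add mg
  have key := H f' g' (fun _ => 1) (pw (1 / s) w) sf sg (Sm.const 1) (sw.pw _ wpos) (fun x => rpow_pos_of_pos (wpos x) _)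
    (fun x => root_bound (by linarith) (by linarith) (by
      have := pf x; have := pg x
      simp only [hw, Pi.add_apply]; linarith))
    (fun x => root_bound (by linarith) (by linarith) (by
      have := pf x; have := pg x
      simp only [hw, Pi.add_apply]; linarith))
    (fun x => by simp) T hT k l
  have e : ∀ x, pw (1 / s) w x ^ s = maj p f' x + maj q g' x := by
    intro x
    rw [pw, ← rpow_mul (wpos x).le, one_div_mul_cancel (by linarith), rpow_one]; rfl
  simp only [e] at key
  rw [integral_add (intOn mf.cont) (intOn mg.cont)] at key
  have e2 : ∀ z : ℝ × (ℝ × ℝ), z.1 * (|He (D k f) z.1 z.2| * |He (D l g) z.1 z.2|) =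
     (A * B) * (z.1 * (|He (fun _ => (1:ℝ)) z.1 z.2| * |He (D k f') z.1 z.2| * |He (D l g') z.1 z.2|)) := by
    intro z
    have : He (fun _ => (1:ℝ)) z.1 z.2 = 1 := by simp [He]
    rw [hf', hg', D_smul k _ hf, D_smul l _ hg, He_smul, He_smul, this]
    simp only [abs_mul, abs_of_pos (inv_pos.2 hA), abs_of_pos (inv_pos.2 hB), abs_one]
    field_simp
  simp only [e2]
  rw [J_const, mul_comm]
  refine mul_le_mul_of_nonneg_right (key.trans ?_) (by positivity)
  gcongr

lemma dual {p q : ℝ} (hp : 1 < p) (hq : 1 < q) (h : 1 / p + 1 / q = 1) {w : ℝ × ℝ → ℝ} (hw : Sm w) {M : ℝ} (hM : 0 ≤ M)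
    (H : ∀ g, Sm g → ∀ B, 0 < B → ∫ x in Q2, |g x| ^ q ≤ B ^ q → ∫ x in Q2, w x * g x ≤ M * B) :
    ∫ x in Q2, |w x| ^ p ≤ M ^ p := by
  have hp0 : 0 < p := by linarith
  have hq0 : 0 < q := by linarith
  have hpq : (p - 1) * q = p := by field_simp at h; linarith
  have key : ∀ ε > 0, ∫ x in Q2, |w x| ^ p ≤ (M + ε) ^ p := by
    intro ε hε
    set y : ℝ × ℝ → ℝ := w * w + fun _ => ε ^ 2 with hy
    have sy : Sm y := (hw.mul hw).add (Sm.const _)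
    have yp : ∀ x, 0 < y x := fun x => by
      simp only [hy, Pi.add_apply, Pi.mul_apply]; nlinarith [mul_self_nonneg (w x), pow_pos hε 2]
    have w_le : ∀ x, |w x| ≤ y x ^ (1/2 : ℝ) := by
      intro x
      rw [← sqrt_eq_rpow]
      apply abs_le_sqrt
      simp only [hy, Pi.add_apply, Pi.mul_apply]; nlinarith [pow_pos hε 2]
    have e_le : ∀ x, ε ≤ y x ^ (1/2 : ℝ) := by
      intro x
      rw [← sqrt_eq_rpow]
      apply le_sqrt_of_sq_le
      simp only [hy, Pi.add_apply, Pi.mul_apply]; nlinarith [mul_self_nonneg (w x)]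
    set A := ∫ x in Q2, y x ^ (p / 2) with hA
    have cy := fun c => (sy.pw c yp).cont
    have hwA : ∫ x in Q2, |w x| ^ p ≤ A := by
      refine setIntegral_mono (intOn (cont_abs_rpow hp0 hw.cont)) (intOn (cy (p/2))) fun x => ?_
      calc |w x| ^ p ≤ (y x ^ (1/2:ℝ)) ^ p := rpow_le_rpow (abs_nonneg _) (w_le x) hp0.le
        _ = y x ^ (p / 2) := by rw [← rpow_mul (yp x).le]; congr 1; ring
    have hA0 : 0 < A := by
      have : ∫ x in Q2, ε ^ p ≤ A := by
        refine setIntegral_mono (integrable_const _) (intOn (cy (p/2))) fun x => ?_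
        calc ε ^ p ≤ (y x ^ (1/2:ℝ)) ^ p := rpow_le_rpow hε.le (e_le x) hp0.le
          _ = y x ^ (p / 2) := by rw [← rpow_mul (yp x).le]; congr 1; ring
      simp at this
      exact (rpow_pos_of_pos hε p).trans_le this
    have gle : ∀ x, |w x * y x ^ ((p - 2) / 2)| ≤ y x ^ ((p - 1) / 2) := by
      intro x
      rw [abs_mul, abs_of_pos (rpow_pos_of_pos (yp x) _)]
      calc _ ≤ y x ^ (1/2 : ℝ) * y x ^ ((p - 2) / 2) := mul_le_mul_of_nonneg_right (w_le x) (rpow_nonneg (yp x).le _)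
        _ = _ := by rw [← rpow_add (yp x)]; congr 1; ring
    have sg : Sm (w * pw ((p - 2)/2) y) := hw.mul (sy.pw _ yp)
    have h1 := H _ sg (A ^ (1 / q)) (rpow_pos_of_pos hA0 _) (by
      rw [← rpow_mul hA0.le, one_div_mul_cancel hq0.ne', rpow_one]
      refine setIntegral_mono (intOn (cont_abs_rpow hq0 sg.cont)) (intOn (cy (p/2))) fun x => ?_
      calc _ ≤ (y x ^ ((p - 1)/2)) ^ q := rpow_le_rpow (abs_nonneg _) (gle x) hq0.le
        _ = y x ^ (p / 2) := by rw [← rpow_mul (yp x).le]; congr 1; linarith)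
    have h2 : ∫ x in Q2, y x ^ ((p - 1) / 2) ≤ A ^ (1 / q) := by
      have e : ∀ x, y x ^ ((p - 1) / 2) = (y x ^ (p / 2)) ^ (1 / q) := by
        intro x
        rw [← rpow_mul (yp x).le]; congr 1; field_simp; linarith
      simp only [e]
      have := (Real.concaveOn_rpow (p := 1 / q) (by positivity) (by rw [div_le_one hq0]; linarith)).le_map_integral
          (μ := volume.restrict Q2) (f := fun x => y x ^ (p / 2))
          (continuousOn_id.rpow_const (fun _ _ => Or.inr (by positivity))) isClosed_Ici
          (ae_of_all _ fun x => (rpow_pos_of_pos (yp x) _).le)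
          (intOn (cy (p/2))) (by
            have this : IntegrableOn (fun x => y x ^ ((p-1)/2)) Q2 := intOn (cy ((p-1)/2))
            simp only [e] at this
            exact this)
      exact this
    have h3 : A ≤ (M + ε) * A ^ (1 / q) := by
      calc A ≤ ∫ x in Q2, (w x * (w * pw ((p - 2)/2) y) x + ε * y x ^ ((p - 1) / 2)) := by
            refine setIntegral_mono (intOn (cy (p/2))) (intOn ?_) fun x => ?_
            · have c1 := cy ((p-1)/2)
              have c2 := sg.cont
              have c3 := hw.cont
              unfold pw at c1
              fun_prop
            · have e1 : y x ^ (p / 2) = y x * y x ^ ((p - 2) / 2) := by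
                rw [show p / 2 = 1 + (p - 2) / 2 by ring, rpow_add (yp x), rpow_one]
              have e2 : y x ^ ((p - 1) / 2) = y x ^ (1/2:ℝ) * y x ^ ((p - 2) / 2) := by
                rw [← rpow_add (yp x)]; congr 1; ring
              have hz := (rpow_pos_of_pos (yp x) ((p - 2) / 2)).le
              have e3 : y x = w x * w x + ε ^ 2 := rfl
              simp only [pw, Pi.mul_apply, pw]
              rw [e1, e2]
              generalize y x ^ ((p - 2) / 2) = Z at *
              have := e_le x
              generalize y x ^ (1/2:ℝ) = Y at *
              rw [e3]
              have : ε * ε * Z ≤ ε * (Y * Z) := by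
                rw [mul_assoc]; gcongr
              nlinarith
        _ = (∫ x in Q2, w x * (w * pw ((p - 2)/2) y) x) + ε * ∫ x in Q2, y x ^ ((p - 1) / 2) := by
            refine (integral_add (f := fun x => w x * (w * pw ((p - 2)/2) y) x) (g := fun x => ε * y x ^ ((p-1)/2)) (intOn (hw.mul sg).cont) ((intOn (cy ((p-1)/2))).const_mul ε)).trans ?_
            rw [integral_const_mul]
        _ ≤ M * A ^ (1 / q) + ε * A ^ (1 / q) := by gcongr
        _ = _ := by ring
    refine hwA.trans ?_
    have h4 : A = A ^ (1 / p) * A ^ (1 / q) := by rw [← rpow_add hA0, h, rpow_one]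
    have h5 : A ^ (1 / p) ≤ M + ε := by
      have := rpow_pos_of_pos hA0 (1 / q)
      rw [← mul_le_mul_iff_left₀ this, ← h4]; exact h3
    calc A = (A ^ (1 / p)) ^ p := by rw [← rpow_mul hA0.le, one_div_mul_cancel hp0.ne', rpow_one]
      _ ≤ _ := rpow_le_rpow (by positivity) h5 hp0.le
  have lim : Tendsto (fun ε : ℝ => (M + ε) ^ p) (𝓝[>] 0) (𝓝 (M ^ p)) := by
    have : Continuous fun ε : ℝ => (M + ε) ^ p := (by fun_prop : Continuous fun ε : ℝ => M + ε).rpow_const fun _ => Or.inr hp0.le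
    have := this.tendsto 0
    simp only [add_zero] at this
    exact this.mono_left nhdsWithin_le_nhds
  exact ge_of_tendsto lim (eventually_mem_nhdsWithin.mono fun ε hε => key ε hε)
end

noncomputable section
set_option linter.unusedSectionVars false
open Set Filter Topology ProbabilityTheory
open scoped ContDiff

lemma nc_neg (n : ℤ × ℤ) (k : Fin 2) : nc (-n) k = - nc n k := by
  fin_cases k <;> simp [nc]

lemma ch_neg (n : ℤ × ℤ) (x : ℝ × ℝ) : (starRingEnd ℂ) (ch n x) = ch (-n) x := by
  simp only [ch]
  rw [← Complex.exp_conj]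
  congr 1
  simp [Complex.conj_ofNat]
  ring

lemma norm_ch (n : ℤ × ℤ) (x : ℝ × ℝ) : ‖ch n x‖ = 1 := by
  simp only [ch]
  rw [show 2 * (π:ℂ) * Complex.I * ((n.1 : ℂ) * (x.1 : ℂ) + (n.2 : ℂ) * (x.2 : ℂ)) =
    ((2 * π * (n.1 * x.1 + n.2 * x.2) : ℝ) : ℂ) * Complex.I by push_cast; ring]
  exact Complex.norm_exp_ofReal_mul_I _

lemma ch_per (n : ℤ × ℤ) : Per (ch n) := by
  constructor
  · intro x
    simp only [ch]
    rw [show 2 * (π:ℂ) * Complex.I * ((n.1 : ℂ) * ((x.1 + 1 : ℝ) : ℂ) + (n.2 : ℂ) * (x.2 : ℂ)) =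
      2 * π * Complex.I * ((n.1 : ℂ) * (x.1 : ℂ) + (n.2 : ℂ) * (x.2 : ℂ)) + n.1 * (2 * π * Complex.I) by push_cast; ring,
      Complex.exp_add, Complex.exp_int_mul_two_pi_mul_I, mul_one]
  · intro x
    simp only [ch]
    rw [show 2 * (π:ℂ) * Complex.I * ((n.1 : ℂ) * (x.1 : ℂ) + (n.2 : ℂ) * ((x.2 + 1 : ℝ) : ℂ)) =
      2 * π * Complex.I * ((n.1 : ℂ) * (x.1 : ℂ) + (n.2 : ℂ) * (x.2 : ℂ)) + n.2 * (2 * π * Complex.I) by push_cast; ring,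
      Complex.exp_add, Complex.exp_int_mul_two_pi_mul_I, mul_one]

lemma ch_sm (n : ℤ × ℤ) : Sm (ch n) := by
  refine ⟨ch_per n, ?_⟩
  unfold ch
  have h1 : ContDiff ℝ ∞ fun x : ℝ × ℝ => ((x.1 : ℝ) : ℂ) := Complex.ofRealCLM.contDiff.comp contDiff_fst
  have h2 : ContDiff ℝ ∞ fun x : ℝ × ℝ => ((x.2 : ℝ) : ℂ) := Complex.ofRealCLM.contDiff.comp contDiff_snd
  exact (contDiff_const.mul ((contDiff_const.mul h1).add (contDiff_const.mul h2))).cexp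

lemma ch_hasFDeriv (n : ℤ × ℤ) (x : ℝ × ℝ) : HasFDerivAt (ch n) 
    ((2 * π * Complex.I * ch n x) • (nc n 0 • Complex.ofRealCLM.comp (ContinuousLinearMap.fst ℝ ℝ ℝ) +
      nc n 1 • Complex.ofRealCLM.comp (ContinuousLinearMap.snd ℝ ℝ ℝ))) x := by
  have h1 : HasFDerivAt (fun x : ℝ × ℝ => ((x.1 : ℝ) : ℂ)) (Complex.ofRealCLM.comp (ContinuousLinearMap.fst ℝ ℝ ℝ)) x :=
    (Complex.ofRealCLM.comp (ContinuousLinearMap.fst ℝ ℝ ℝ)).hasFDerivAt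
  have h2 : HasFDerivAt (fun x : ℝ × ℝ => ((x.2 : ℝ) : ℂ)) (Complex.ofRealCLM.comp (ContinuousLinearMap.snd ℝ ℝ ℝ)) x :=
    (Complex.ofRealCLM.comp (ContinuousLinearMap.snd ℝ ℝ ℝ)).hasFDerivAt
  have := (((h1.const_mul (n.1 : ℂ)).add (h2.const_mul (n.2 : ℂ))).const_mul (2 * π * Complex.I)).cexp
  refine this.congr_fderiv ?_
  rw [smul_smul]
  simp only [nc, ch]
  congr 1
  simp
  ring

lemma D_ch (n : ℤ × ℤ) (k : Fin 2) : D k (ch n) = fun x => 2 * π * Complex.I * nc n k * ch n x := by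
  funext x
  rw [HasFDerivAt_D (ch_hasFDeriv n x)]
  fin_cases k <;> simp [ee] <;> ring

lemma fc_eq (f : ℝ × ℝ → ℂ) (n : ℤ × ℤ) : fc f n = ∫ x in Q2, f x * ch (-n) x := by
  simp only [fc, ch_neg]

lemma fc_D {f : ℝ × ℝ → ℂ} (hf : Sm f) (k : Fin 2) (n : ℤ × ℤ) :
    fc (D k f) n = 2 * π * Complex.I * nc n k * fc f n := by
  have h0 := int_D (hf.mulC (ch_sm (-n))) k
  rw [D_mulC k hf (ch_sm _), D_ch, nc_neg] at h0
  have h1 : (∫ x in Q2, f x * (2 * π * Complex.I * -nc n k * ch (-n) x)) + ∫ x in Q2, D k f x * ch (-n) x = 0 := by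
    refine (integral_add (intOn ?_) (intOn ?_)).symm.trans h0
    · have := hf.cont
      have := (ch_sm (-n)).cont
      fun_prop
    · exact ((hf.D k).mulC (ch_sm (-n))).cont
  rw [← fc_eq] at h1
  have h2 : ∫ x in Q2, f x * (2 * π * Complex.I * -nc n k * ch (-n) x) = (2 * π * Complex.I * -nc n k) * fc f n := by
    rw [fc_eq, ← integral_const_mul]
    congr 1; funext x; ring
  rw [h2] at h1
  linear_combination h1

lemma fc_sub {f g : ℝ × ℝ → ℂ} (hf : Sm f) (hg : Sm g) (n : ℤ × ℤ) : fc (f - g) n = fc f n - fc g n := by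
  simp only [fc_eq]
  refine Eq.trans ?_ (integral_sub (intOn (hf.mulC (ch_sm (-n))).cont) (intOn (hg.mulC (ch_sm (-n))).cont))
  congr 1; funext x; simp; ring

lemma fc_bound {f : ℝ × ℝ → ℂ} {C : ℝ} (hC : ∀ x, ‖f x‖ ≤ C) (n : ℤ × ℤ) : ‖fc f n‖ ≤ C := by
  have := norm_integral_le_of_norm_le_const (μ := volume.restrict Q2) (f := fun x => f x * ch (-n) x) (C := C)
    (ae_of_all _ fun y => by rw [norm_mul, norm_ch, mul_one]; exact hC y)
  rw [fc_eq]; simpa [Q2_vol, measureReal_def] using this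

lemma summ1 : Summable fun n : ℤ => (1 + (n:ℝ) ^ 2)⁻¹ := by
  have h1 : Summable fun n : ℤ => 1 / (n:ℝ) ^ 2 := Real.summable_one_div_int_pow.2 (by norm_num)
  have h2 : Summable fun n : ℤ => if n = 0 then (1:ℝ) else 0 :=
    summable_of_ne_finset_zero (s := {0}) (by intro n hn; simp at hn; simp [hn])
  refine Summable.of_nonneg_of_le (fun n => by positivity) (fun n => ?_) (h1.add h2)
  by_cases hn : n = 0
  · simp [hn]
  · have : (0:ℝ) < (n:ℝ) ^ 2 := by positivity
    simp only [hn, if_false, add_zero, ← one_div]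
    gcongr; linarith

lemma summ2 : Summable fun n : ℤ × ℤ => (1 + (n.1:ℝ) ^ 2)⁻¹ * (1 + (n.2:ℝ) ^ 2)⁻¹ :=
  summ1.mul_of_nonneg summ1 (fun n => by positivity) (fun n => by positivity)

lemma fc_summ {f : ℝ × ℝ → ℂ} (hf : Sm f) : Summable fun n => ‖fc f n‖ := by
  set g := f - D 0 (D 0 f) with hg
  have sg : Sm g := hf.sub ((hf.D 0).D 0)
  set h := g - D 1 (D 1 g) with hh
  have sh : Sm h := sg.sub ((sg.D 1).D 1)
  obtain ⟨C, hC0, hC⟩ := sh.bound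
  refine Summable.of_nonneg_of_le (fun n => norm_nonneg _) (fun n => ?_) (summ2.mul_left C)
  have e : fc h n = ((1 + (2 * π * n.1) ^ 2 : ℝ) * (1 + (2 * π * n.2) ^ 2 : ℝ) : ℂ) * fc f n := by
    rw [hh, fc_sub sg ((sg.D 1).D 1), fc_D (sg.D 1), fc_D sg, hg, fc_sub hf ((hf.D 0).D 0), fc_D (hf.D 0), fc_D hf]
    simp only [nc]
    simp
    ring_nf
    simp only [Complex.I_sq, show Complex.I ^ 4 = 1 by rw [show 4 = 2 * 2 by rfl, pow_mul, Complex.I_sq]; norm_num]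
    ring
  have e2 := fc_bound hC n
  rw [e, norm_mul, norm_mul, Complex.norm_real, Complex.norm_real, Real.norm_of_nonneg (by positivity), Real.norm_of_nonneg (by positivity)] at e2
  have pi1 : (1:ℝ) ≤ (2 * π) ^ 2 := by nlinarith [pi_gt_three]
  have a1 : 1 + (n.1:ℝ) ^ 2 ≤ 1 + (2 * π * n.1) ^ 2 := by
    rw [mul_pow]; nlinarith [sq_nonneg (n.1 : ℝ)]
  have a2 : 1 + (n.2:ℝ) ^ 2 ≤ 1 + (2 * π * n.2) ^ 2 := by
    rw [mul_pow]; nlinarith [sq_nonneg (n.2 : ℝ)]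
  have a3 : (1 + (n.1:ℝ) ^ 2) * (1 + (n.2:ℝ) ^ 2) * ‖fc f n‖ ≤ C := by
    refine le_trans ?_ e2
    gcongr
  rw [← mul_inv, ← div_eq_mul_inv, le_div_iff₀ (by positivity)]
  linarith

open UnitAddTorus in
lemma fc_inv {f : ℝ × ℝ → ℂ} (hf : Sm f) (x : ℝ × ℝ) : HasSum (fun n => fc f n * ch n x) (f x) := by
  set π' : (Fin 2 → ℝ) → UnitAddTorus (Fin 2) := fun y i => (y i : UnitAddCircle) with hπ
  have hq : IsOpenQuotientMap π' := 
    IsOpenQuotientMap.piMap (fun _ => QuotientAddGroup.isOpenQuotientMap_mk)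
  set F : UnitAddTorus (Fin 2) → ℂ := fun t => f ((AddCircle.equivIoc 1 0 (t 0)).1, (AddCircle.equivIoc 1 0 (t 1)).1) with hF
  have hFπ : ∀ y, F (π' y) = f (y 0, y 1) := by
    intro y
    have a : ∀ i, ∃ m : ℤ, (AddCircle.equivIoc 1 0 (π' y i)).1 = y i + m := by
      intro i
      have : ((AddCircle.equivIoc 1 0 (π' y i)).1 : UnitAddCircle) = (y i : UnitAddCircle) :=
        (AddCircle.equivIoc (1:ℝ) 0).symm_apply_apply (π' y i)
      rw [← sub_eq_zero, ← AddCircle.coe_sub, AddCircle.coe_eq_zero_iff] at this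
      obtain ⟨m, hm⟩ := this
      refine ⟨m, ?_⟩
      simp at hm
      linarith
    obtain ⟨m, hm⟩ := a 0
    obtain ⟨n, hn⟩ := a 1
    simp only [hF, hm, hn]
    exact hf.1.int m n (y 0, y 1)
  have hFc : Continuous F := by
    rw [hq.isQuotientMap.continuous_iff]
    have : F ∘ π' = fun y => f (y 0, y 1) := funext hFπ
    rw [this]
    have := hf.cont
    fun_prop
  have hmf : ∀ (n : Fin 2 → ℤ) (y : Fin 2 → ℝ), mFourier n (π' y) = ch (n 0, n 1) (y 0, y 1) := by
    intro n y
    simp only [mFourier, ContinuousMap.coe_mk, Fin.prod_univ_two, hπ, fourier_coe_apply, ch]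
    rw [← Complex.exp_add]
    congr 1
    push_cast; ring
  have hco : ∀ n, mFourierCoeff F n = fc f (n 0, n 1) := by
    intro n
    rw [mFourierCoeff_eq_integral F n 0, fc_eq]
    have e : ∀ y : Fin 2 → ℝ, mFourier (-n) (fun i => (y i : UnitAddCircle)) • F (fun i => (y i : UnitAddCircle))
        = (fun z => f z * ch (-(n 0, n 1)) z) (MeasurableEquiv.finTwoArrow y) := by
      intro y
      rw [show (fun i => (y i : UnitAddCircle)) = π' y from rfl, hmf, hFπ, smul_eq_mul, mul_comm]
      rfl
    simp only [e]
    have hs : {y : Fin 2 → ℝ | ∀ i, y i ∈ Ioc ((0 : Fin 2 → ℝ) i) ((0 : Fin 2 → ℝ) i + 1)} = 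
       MeasurableEquiv.finTwoArrow ⁻¹' (Ioc (0:ℝ) 1 ×ˢ Ioc (0:ℝ) 1) := by
      ext y; simp [Fin.forall_fin_two, MeasurableEquiv.finTwoArrow]
    rw [hs]
    refine ((volume_preserving_finTwoArrow ℝ).setIntegral_preimage_emb (MeasurableEquiv.measurableEmbedding _) (fun z => f z * ch (-(n 0, n 1)) z) _).trans ?_
    apply setIntegral_congr_set
    rw [Q2, Measure.volume_eq_prod]
    exact (Measure.set_prod_ae_eq Ioo_ae_eq_Ioc Ioo_ae_eq_Ioc).symm
  have hs : Summable (mFourierCoeff (⟨F, hFc⟩ : C(UnitAddTorus (Fin 2), ℂ))) := by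
    have := (fc_summ hf).of_norm
    have := (Equiv.summable_iff (finTwoArrowEquiv ℤ)).2 this
    refine this.congr fun n => ?_
    exact (hco n).symm
  have := hasSum_mFourier_series_apply_of_summable hs (π' ![x.1, x.2])
  rw [← Equiv.hasSum_iff (finTwoArrowEquiv ℤ)]
  have e : f x = (⟨F, hFc⟩ : C(UnitAddTorus (Fin 2), ℂ)) (π' ![x.1, x.2]) := by
    exact (hFπ ![x.1,x.2]).symm
  rw [e]
  refine this.congr_fun fun n => ?_
  rw [hmf]
  have := hco n
  simp only [Function.comp]
  change _ = mFourierCoeff F n • _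
  rw [this]
  rfl

/-- the multiplier -/
def mm (i j : Fin 2) (n : ℤ × ℤ) : ℂ :=
  if n = 0 then 0 else -(nc n i * nc n j) / ((((n.1 : ℝ) ^ 2 + (n.2 : ℝ) ^ 2 : ℝ)) : ℂ)

lemma RRz_eq (i j : Fin 2) (f : ℝ × ℝ → ℂ) (x : ℝ × ℝ) : RRz i j f x = ∑' n, mm i j n * fc f n * ch n x := by
  unfold RRz mm
  congr 1; funext n
  split_ifs <;> simp

lemma mm_neg (i j : Fin 2) (n : ℤ × ℤ) : mm i j (-n) = mm i j n := by
  simp [mm, nc_neg]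

lemma nc_le (n : ℤ × ℤ) (i : Fin 2) : ‖nc n i‖ ^ 2 ≤ (n.1 : ℝ) ^ 2 + (n.2 : ℝ) ^ 2 := by
  fin_cases i <;> simp [nc] <;> positivity

lemma mm_le (i j : Fin 2) (n : ℤ × ℤ) : ‖mm i j n‖ ≤ 1 := by
  unfold mm
  split_ifs
  · simp
  · have h1 := nc_le n i
    have h2 := nc_le n j
    rw [norm_div, norm_neg, norm_mul, Complex.norm_real, Real.norm_of_nonneg (by positivity)]
    refine div_le_one_of_le₀ ?_ (by positivity)
    nlinarith [sq_nonneg (‖nc n i‖ - ‖nc n j‖)]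

lemma mm_lap (i j : Fin 2) (n : ℤ × ℤ) : (nc n 0 * nc n 0 + nc n 1 * nc n 1) * mm i j n = - (nc n i * nc n j) := by
  unfold mm
  split_ifs with h
  · subst h
    fin_cases i <;> simp [nc]
  · have : ((((n.1 : ℝ) ^ 2 + (n.2 : ℝ) ^ 2 : ℝ)) : ℂ) ≠ 0 := by
      rw [Complex.ofReal_ne_zero]
      intro h0
      apply h
      have a : (n.1:ℝ) = 0 := by nlinarith [sq_nonneg (n.1:ℝ), sq_nonneg (n.2:ℝ)]
      have b : (n.2:ℝ) = 0 := by nlinarith [sq_nonneg (n.1:ℝ), sq_nonneg (n.2:ℝ)]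
      ext
      · exact_mod_cast a
      · exact_mod_cast b
    rw [mul_div_assoc', div_eq_iff this]
    simp [nc]; ring

lemma RR_summ (i j : Fin 2) {f : ℝ × ℝ → ℂ} (hf : Sm f) : Summable fun n => ‖mm i j n * fc f n‖ := by
  refine Summable.of_nonneg_of_le (fun n => norm_nonneg _) (fun n => ?_) (fc_summ hf)
  rw [norm_mul]
  exact mul_le_of_le_one_left (norm_nonneg _) (mm_le i j n)

lemma RR_summ' (i j : Fin 2) {f : ℝ × ℝ → ℂ} (hf : Sm f) (x : ℝ × ℝ) : Summable fun n => mm i j n * fc f n * ch n x := by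
  refine Summable.of_norm ?_
  simpa only [norm_mul, norm_ch, mul_one] using RR_summ i j hf

lemma RR_hasSum (i j : Fin 2) {f : ℝ × ℝ → ℂ} (hf : Sm f) (x : ℝ × ℝ) : HasSum (fun n => mm i j n * fc f n * ch n x) (RRz i j f x) := by
  rw [RRz_eq]; exact (RR_summ' i j hf x).hasSum

lemma RR_D (i j : Fin 2) {f : ℝ × ℝ → ℂ} (hf : Sm f) : Differentiable ℝ (RRz i j f) ∧ ∀ k, D k (RRz i j f) = RRz i j (D k f) := by
  set L : ℤ × ℤ → ℝ × ℝ → (ℝ × ℝ →L[ℝ] ℂ) := fun n x =>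
    (mm i j n * fc f n) • ((2 * π * Complex.I * ch n x) • (nc n 0 • Complex.ofRealCLM.comp (ContinuousLinearMap.fst ℝ ℝ ℝ) +
      nc n 1 • Complex.ofRealCLM.comp (ContinuousLinearMap.snd ℝ ℝ ℝ))) with hL
  have hLk : ∀ n x k, L n x (ee k) = mm i j n * fc (D k f) n * ch n x := by
    intro n x k
    rw [fc_D hf]
    fin_cases k <;> simp [ee, hL] <;> ring
  have hLn : ∀ n x, ‖L n x‖ ≤ ‖mm i j n * fc (D 0 f) n‖ + ‖mm i j n * fc (D 1 f) n‖ := by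
    intro n x
    refine ContinuousLinearMap.opNorm_le_bound _ (by positivity) fun v => ?_
    rw [fderiv_decomp, hLk, hLk]
    refine (norm_add_le _ _).trans ?_
    rw [norm_smul, norm_smul, norm_mul _ (ch n x), norm_mul _ (ch n x), norm_ch, mul_one, mul_one, add_mul]
    have a := norm_fst_le v
    have b := norm_snd_le v
    rw [mul_comm ‖v.1‖, mul_comm ‖v.2‖]
    gcongr
  have hd : ∀ x, HasFDerivAt (RRz i j f) (∑' n, L n x) x := by
    intro x
    have := hasFDerivAt_tsum (f := fun n x => mm i j n * fc f n * ch n x) (f' := L) ((RR_summ i j (hf.D 0)).add (RR_summ i j (hf.D 1)))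
      (fun n x => (ch_hasFDeriv n x).const_mul _) hLn (RR_summ' i j hf x) x
    have e : RRz i j f = fun x => ∑' n, mm i j n * fc f n * ch n x := funext fun x => RRz_eq i j f x
    rw [e]; exact this
  refine ⟨fun x => (hd x).differentiableAt, fun k => funext fun x => ?_⟩
  rw [HasFDerivAt_D (hd x), RRz_eq]
  have hs : Summable fun n => L n x :=
    Summable.of_norm_bounded ((RR_summ i j (hf.D 0)).add (RR_summ i j (hf.D 1))) (fun n => hLn n x)
  have := (ContinuousLinearMap.apply ℝ ℂ (ee k)).map_tsum hs
  simpa only [ContinuousLinearMap.apply_apply, hLk] using this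

lemma RR_sm (i j : Fin 2) {f : ℝ × ℝ → ℂ} (hf : Sm f) : Sm (RRz i j f) := by
  refine ⟨⟨fun x => ?_, fun x => ?_⟩, ?_⟩
  · simp only [RRz_eq, (ch_per _).1 x]
  · simp only [RRz_eq, (ch_per _).2 x]
  · refine contDiff_of_D (C := fun g => ∃ f, Sm f ∧ g = RRz i j f) ?_ ?_ _ ⟨f, hf, rfl⟩
    · rintro _ ⟨f, hf, rfl⟩; exact (RR_D i j hf).1
    · rintro _ ⟨f, hf, rfl⟩ k; exact ⟨_, hf.D k, (RR_D i j hf).2 k⟩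

lemma RR_lap (i j : Fin 2) {f : ℝ × ℝ → ℂ} (hf : Sm f) (x : ℝ × ℝ) :
    RRz i j (D 0 (D 0 f)) x + RRz i j (D 1 (D 1 f)) x = - D i (D j f) x := by
  have h1 := (RR_hasSum i j ((hf.D 0).D 0) x).add (RR_hasSum i j ((hf.D 1).D 1) x)
  have h2 := (fc_inv ((hf.D j).D i) x).neg
  refine h1.unique (h2.congr_fun fun n => ?_)
  rw [fc_D (hf.D 0), fc_D (hf.D 1), fc_D (hf.D j), fc_D hf, fc_D hf, fc_D hf]
  have := mm_lap i j n
  linear_combination ((2 * π * Complex.I) ^ 2 * fc f n * ch n x) * this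

lemma RR_int (i j : Fin 2) {f g : ℝ × ℝ → ℂ} (hf : Sm f) (hg : Sm g) :
    ∫ x in Q2, RRz i j f x * g x = ∑' n, mm i j n * fc f n * fc g (-n) := by
  obtain ⟨C, hC0, hC⟩ := hg.bound
  have cg := hg.cont
  have := hasSum_integral_of_dominated_convergence (μ := volume.restrict Q2) (F := fun n x => mm i j n * fc f n * ch n x * g x)
    (f := fun x => RRz i j f x * g x) (bound := fun n x => ‖mm i j n * fc f n‖ * C)
    (fun n => by
      have := (ch_sm n).cont
      exact (by fun_prop : Continuous _).aestronglyMeasurable)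
    (fun n => ae_of_all _ fun x => by
      rw [norm_mul, norm_mul _ (ch n x), norm_ch, mul_one]; gcongr; exact hC x)
    (ae_of_all _ fun x => (RR_summ i j hf).mul_right C)
    (integrable_const _)
    (ae_of_all _ fun x => (RR_hasSum i j hf x).mul_right (g x))
  rw [← this.tsum_eq]
  congr 1; funext n
  rw [fc_eq g, ← integral_const_mul, neg_neg]
  congr 1; funext x; ring

lemma RR_symm (i j : Fin 2) {f g : ℝ × ℝ → ℂ} (hf : Sm f) (hg : Sm g) :
    ∫ x in Q2, RRz i j f x * g x = ∫ x in Q2, f x * RRz i j g x := by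
  have : ∫ x in Q2, f x * RRz i j g x = ∫ x in Q2, RRz i j g x * f x := by
    congr 1; funext x; ring
  rw [this, RR_int i j hf hg, RR_int i j hg hf, ← (Equiv.neg (ℤ × ℤ)).tsum_eq]
  congr 1; funext n
  simp [mm_neg]; ring

lemma RR_mean (i j : Fin 2) {f : ℝ × ℝ → ℂ} (hf : Sm f) : ∫ x in Q2, RRz i j f x = 0 := by
  have h := RR_symm i j hf (Sm.const (1:ℂ))
  simp only [mul_one] at h
  rw [h]
  have : ∀ x, RRz i j (fun _ => (1:ℂ)) x = 0 := by
    intro x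
    rw [RRz_eq]
    have : ∀ n, mm i j n * fc (fun _ => (1:ℂ)) n * ch n x = 0 := by
      intro n
      by_cases hn : n = 0
      · simp [mm, hn]
      · have a : ∀ k, nc n k * fc (fun _ => (1:ℂ)) n = 0 := by
          intro k
          have h1 := fc_D (Sm.const (1:ℂ)) k n
          have h2 : D k (fun _ : ℝ × ℝ => (1:ℂ)) = fun _ => 0 := by
            funext x; simp [D]
          rw [h2] at h1
          have h3 : fc (fun _ => 0) n = 0 := by simp [fc]
          rw [h3] at h1
          have : (2 * π * Complex.I : ℂ) ≠ 0 := Complex.two_pi_I_ne_zero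
          rw [mul_assoc] at h1
          rcases mul_eq_zero.1 h1.symm with h | h
          · exact absurd h this
          · exact h
        simp only [mm, hn, if_false]
        linear_combination (-(nc n j) / ((((n.1 : ℝ) ^ 2 + (n.2 : ℝ) ^ 2 : ℝ)) : ℂ) * ch n x) * a i
    simp only [this, tsum_zero]
  simp [this]

lemma RR_real (i j : Fin 2) (f : ℝ × ℝ → ℝ) (x : ℝ × ℝ) :
    (starRingEnd ℂ) (RRz i j (fun y => (f y : ℂ)) x) = RRz i j (fun y => (f y : ℂ)) x := by
  rw [RRz_eq, Complex.conj_tsum]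
  rw [← (Equiv.neg (ℤ × ℤ)).tsum_eq]
  congr 1; funext n
  have a : (starRingEnd ℂ) (fc (fun y => (f y : ℂ)) (-n)) = fc (fun y => (f y : ℂ)) n := by
    rw [fc, ← integral_conj, fc]
    simp only [map_mul, Complex.conj_ofReal, ch_neg, neg_neg]
  have c : ∀ k, (starRingEnd ℂ) (nc n k) = nc n k := by
    intro k; fin_cases k <;> simp [nc]
  have b : (starRingEnd ℂ) (mm i j n) = mm i j n := by
    unfold mm; split_ifs
    · simp
    · rw [map_div₀, map_neg, map_mul, c, c, Complex.conj_ofReal]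
  simp only [Equiv.neg_apply, map_mul, mm_neg, a, b, ch_neg, neg_neg]

/-- real operator -/
def Tr (i j : Fin 2) (f : ℝ × ℝ → ℝ) (x : ℝ × ℝ) : ℝ := (RRz i j (fun y => (f y : ℂ)) x).re

lemma Tr_coe (i j : Fin 2) (f : ℝ × ℝ → ℝ) (x : ℝ × ℝ) : ((Tr i j f x : ℝ) : ℂ) = RRz i j (fun y => (f y : ℂ)) x :=
  Complex.conj_eq_iff_re.1 (RR_real i j f x)

lemma Sm.coe {f : ℝ × ℝ → ℝ} (hf : Sm f) : Sm (fun y => (f y : ℂ)) :=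
  ⟨⟨fun x => congrArg _ (hf.1.1 x), fun x => congrArg _ (hf.1.2 x)⟩, Complex.ofRealCLM.contDiff.comp hf.2⟩

lemma D_coe {f : ℝ × ℝ → ℝ} (hf : Sm f) (k : Fin 2) : D k (fun y => (f y : ℂ)) = fun y => ((D k f y : ℝ) : ℂ) := by
  funext x
  exact HasFDerivAt_D (f := fun y => ((f y : ℝ) : ℂ)) (Complex.ofRealCLM.hasFDerivAt.comp x (hf.diff x).hasFDerivAt) k

lemma Tr_sm (i j : Fin 2) {f : ℝ × ℝ → ℝ} (hf : Sm f) : Sm (Tr i j f) := by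
  have h := RR_sm i j hf.coe
  exact ⟨⟨fun x => by simp only [Tr]; rw [h.1.1], fun x => by simp only [Tr]; rw [h.1.2]⟩, Complex.reCLM.contDiff.comp h.2⟩

lemma Tr_D (i j : Fin 2) {f : ℝ × ℝ → ℝ} (hf : Sm f) (k : Fin 2) : D k (Tr i j f) = Tr i j (D k f) := by
  funext x
  have h := (RR_D i j hf.coe)
  have h2 : D k (fun y => ((Tr i j f y : ℝ) : ℂ)) x = ((Tr i j (D k f) x : ℝ) : ℂ) := by
    rw [Tr_coe, ← D_coe hf, ← h.2 k]
    congr 1; funext y; exact Tr_coe i j f y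
  rw [D_coe (Tr_sm i j hf)] at h2
  exact Complex.ofReal_injective h2

lemma Tr_lap (i j : Fin 2) {f : ℝ × ℝ → ℝ} (hf : Sm f) :
    D 0 (D 0 (Tr i j f)) + D 1 (D 1 (Tr i j f)) = - D i (D j f) := by
  funext x
  have h := RR_lap i j hf.coe x
  rw [Tr_D i j hf, Tr_D i j hf, Tr_D i j (hf.D 0), Tr_D i j (hf.D 1)]
  simp only [D_coe hf, D_coe (hf.D _)] at h
  rw [← Tr_coe, ← Tr_coe] at h
  simp only [Pi.add_apply, Pi.neg_apply]
  exact_mod_cast h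

lemma Tr_symm (i j : Fin 2) {f g : ℝ × ℝ → ℝ} (hf : Sm f) (hg : Sm g) :
    ∫ x in Q2, Tr i j f x * g x = ∫ x in Q2, f x * Tr i j g x := by
  have h := RR_symm i j hf.coe hg.coe
  simp only [← Tr_coe, ← Complex.ofReal_mul, integral_complex_ofReal] at h
  exact_mod_cast h

lemma Tr_mean (i j : Fin 2) {f : ℝ × ℝ → ℝ} (hf : Sm f) : ∫ x in Q2, Tr i j f x = 0 := by
  have h := RR_mean i j hf.coe
  simp only [← Tr_coe, integral_complex_ofReal] at h
  exact_mod_cast h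
end

noncomputable section
set_option linter.unusedSectionVars false
open Set Filter Topology ProbabilityTheory
open scoped ContDiff

lemma norm_L_le {V : Type} [NormedAddCommGroup V] [NormedSpace ℝ V] [CompleteSpace V] (L : ℝ × ℝ →L[ℝ] V) :
    ‖L‖ ≤ ‖L (ee 0)‖ + ‖L (ee 1)‖ := by
  refine ContinuousLinearMap.opNorm_le_bound _ (by positivity) fun v => ?_
  rw [fderiv_decomp]
  refine (norm_add_le _ _).trans ?_
  rw [norm_smul, norm_smul, add_mul, mul_comm ‖v.1‖, mul_comm ‖v.2‖]
  have a := norm_fst_le v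
  have b := norm_snd_le v
  gcongr

lemma int_div {Θ Θ' X Y Z W : ℝ × ℝ → ℝ} (hΘ' : Continuous Θ') (hX : Sm X) (hY : Sm Y) (hZ : Sm Z) (hW : Sm W)
    (i j k l : Fin 2) (h : ∀ x, Θ x = Θ' x + (D i X x + D j Y x + D k Z x + D l W x)) :
    ∫ x in Q2, Θ x = ∫ x in Q2, Θ' x := by
  have e : ∫ x in Q2, (D i X x + D j Y x + D k Z x + D l W x) = 0 := by
    have hX' := (hX.D i).cont
    have hY' := (hY.D j).cont
    have hZ' := (hZ.D k).cont
    have hW' := (hW.D l).cont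
    rw [integral_add (intOn (by fun_prop)) (intOn hW'), integral_add (intOn (by fun_prop)) (intOn hZ'),
      integral_add (intOn hX') (intOn hY'), int_D hX, int_D hY, int_D hZ, int_D hW]
    simp
  simp only [h]
  rw [integral_add (intOn hΘ') (intOn ?_), e, add_zero]
  have hX' := (hX.D i).cont
  have hY' := (hY.D j).cont
  have hZ' := (hZ.D k).cont
  have hW' := (hW.D l).cont
  fun_prop

lemma lim_le {Ψ : ℝ → ℝ} {C M : ℝ} (h : ∀ T > 0, |Ψ T| ≤ C / T) (h2 : ∀ T > 0, |Ψ T - Ψ 0| ≤ M) : |Ψ 0| ≤ M := by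
  have l : Tendsto (fun T : ℝ => M + C / T) atTop (𝓝 (M + 0)) := tendsto_const_nhds.add (tendsto_const_nhds.div_atTop tendsto_id)
  rw [add_zero] at l
  refine ge_of_tendsto l ((eventually_gt_atTop 0).mono fun T hT => ?_)
  have a := h T hT
  have b := h2 T hT
  rw [abs_le] at *
  constructor <;> linarith [a.1, a.2, b.1, b.2]

lemma abs_int_le {f : ℝ × ℝ → ℝ} {C : ℝ} (h : ∀ x ∈ Q2, |f x| ≤ C) : |∫ x in Q2, f x| ≤ C := by
  have := norm_setIntegral_le_of_norm_le_const (μ := volume) (s := Q2) (f := f) (C := C) (by simp [Q2_vol]) h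
  simpa [measureReal_def, Q2_vol] using this

lemma J_zero (T : ℝ) : J T (fun _ => 0) = 0 := by simp [J]

lemma He_slice {f : ℝ × ℝ → ℝ} (hf : Sm f) (τ : ℝ) : Continuous (He f τ) := (hf.He τ).cont

lemma He_mean {f : ℝ × ℝ → ℝ} (hf : Sm f) {T : ℝ} (hT : 0 ≤ T) : ∫ x in Q2, He f T x = ∫ x in Q2, f x := by
  have c0 := He_cont ((hf.D 0).D 0)
  have c1 := He_cont ((hf.D 1).D 1)
  have h := J_ftc hT (Ψ := fun τ x => He f τ x) (ψ := fun τ x => τ * (He (D 0 (D 0 f)) τ x + He (D 1 (D 1 f)) τ x))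
    (by fun_prop) (fun τ => He_slice hf τ) (fun x τ => He_deriv hf x τ)
  rw [J_congr (Θ' := fun _ => 0) (by fun_prop) (by fun_prop), J_zero, He_zero] at h
  · linarith
  · intro τ
    simp only [← D_He ((hf.D _)), ← D_He hf]
    rw [integral_const_mul]
    have := int_div (Θ := fun x => D 0 (D 0 (He f τ)) x + D 1 (D 1 (He f τ)) x) (Θ' := fun _ => 0) (by fun_prop)
       ((hf.He τ).D 0) ((hf.He τ).D 1) (Sm.const 0) (Sm.const 0) 0 1 0 0 (by intro x; simp [D])
    rw [this]; simp

lemma He_osc {f : ℝ × ℝ → ℝ} (hf : Sm f) : ∃ C, 0 ≤ C ∧ ∀ T > 0, ∀ x ∈ Q2, |He f T x - He f T 0| ≤ C / T := by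
  obtain ⟨C0, h0, H0⟩ := He_D_decay hf 0
  obtain ⟨C1, h1, H1⟩ := He_D_decay hf 1
  refine ⟨C0 + C1, by positivity, fun T hT x hx => ?_⟩
  have := convex_univ.norm_image_sub_le_of_norm_fderiv_le (𝕜 := ℝ) (f := He f T) (C := (C0 + C1) / T) (x := 0) (y := x)
    (fun y _ => (hf.He T).diff y) (fun y _ => by
      refine (norm_L_le _).trans ?_
      have a := H0 T hT y
      have b := H1 T hT y
      rw [← D_He hf] at a b
      rw [add_div]
      exact add_le_add a b) (mem_univ _) (mem_univ _)
  rw [Real.norm_eq_abs] at this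
  refine this.trans ?_
  have hx1 : ‖x - 0‖ ≤ 1 := by
    rw [sub_zero, Prod.norm_def]
    have := hx.1; have := hx.2
    simp only [mem_Ioo, Real.norm_eq_abs] at *
    rw [max_le_iff, abs_le, abs_le]
    refine ⟨⟨?_, ?_⟩, ⟨?_, ?_⟩⟩ <;> linarith [hx.1.1, hx.1.2, hx.2.1, hx.2.2]
  exact mul_le_of_le_one_right (by positivity) hx1

lemma He_lap (i j : Fin 2) {f : ℝ × ℝ → ℝ} (hf : Sm f) (τ : ℝ) (x : ℝ × ℝ) :
    D 0 (D 0 (He (Tr i j f) τ)) x + D 1 (D 1 (He (Tr i j f) τ)) x = - D i (D j (He f τ)) x := by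
  have hv := Tr_sm i j hf
  rw [D_He hv, D_He hv, D_He (hv.D _), D_He (hv.D _), D_He hf, D_He (hf.D _)]
  have e1 : He (D 0 (D 0 (Tr i j f)) + D 1 (D 1 (Tr i j f))) τ x = He (D 0 (D 0 (Tr i j f))) τ x + He (D 1 (D 1 (Tr i j f))) τ x :=
    integral_add (((hv.D 0).D 0).int_ga x τ) (((hv.D 1).D 1).int_ga x τ)
  have e2 : He (-D i (D j f)) τ x = - He (D i (D j f)) τ x := integral_neg _
  rw [← e1, Tr_lap i j hf, e2]

lemma riesz {p : ℝ} (hp : 1 < p) : ∃ C, 0 < C ∧ ∀ i j, ∀ f : ℝ × ℝ → ℝ, Sm f → ∀ A, 0 < A → ∫ x in Q2, |f x| ^ p ≤ A ^ p →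
    ∫ x in Q2, |Tr i j f x| ^ p ≤ (C * A) ^ p := by
  obtain ⟨q, hq, hpq⟩ : ∃ q, 1 < q ∧ 1 / p + 1 / q = 1 := by
    refine ⟨p / (p - 1), ?_, ?_⟩
    · rw [lt_div_iff₀ (by linarith)]; linarith
    · have : p - 1 ≠ 0 := by linarith
      field_simp; ring
  obtain ⟨C, hC0, hC⟩ := BL hp hq hpq
  refine ⟨2 * C + 1, by positivity, fun i j f hf A hA hfA => ?_⟩
  have hv := Tr_sm i j hf
  refine dual hp hq hpq hv (by positivity) fun g hg B hB hgB => ?_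
  set v := Tr i j f with hvdef
  have key : |∫ x in Q2, He v 0 x * He g 0 x| ≤ 2 * (C * (A * B)) := by
    obtain ⟨K, hK0, hK⟩ := hv.bound
    obtain ⟨K', hK0', hK'⟩ := He_osc hg
    refine lim_le (Ψ := fun T => ∫ x in Q2, He v T x * He g T x) (C := K * K') (fun T hT => ?_) (fun T hT => ?_)
    · have e : ∫ x in Q2, He v T x * He g T x = ∫ x in Q2, He v T x * (He g T x - He g T 0) := by
        have a : ∫ x in Q2, He v T x * He g T 0 = 0 := by
          rw [integral_mul_const, He_mean hv hT.le, Tr_mean i j hf, zero_mul]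
        have c1 := He_slice hv T
        have c2 := He_slice hg T
        have : ∫ x in Q2, He v T x * (He g T x - He g T 0) = (∫ x in Q2, He v T x * He g T x) - ∫ x in Q2, He v T x * He g T 0 := by
          rw [← integral_sub (intOn (by fun_prop)) (intOn (by fun_prop))]
          congr 1; funext x; ring
        rw [this, a, sub_zero]
      rw [e]
      refine abs_int_le fun x hx => ?_
      rw [abs_mul, mul_div_assoc]
      gcongr
      · exact He_bound hK T x
      · exact hK' T hT x hx
    · have cv := He_cont hv
      have cg := He_cont hg
      have cv0 := He_cont ((hv.D 0).D 0)
      have cv1 := He_cont ((hv.D 1).D 1)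
      have cg0 := He_cont ((hg.D 0).D 0)
      have cg1 := He_cont ((hg.D 1).D 1)
      have cF := He_cont (hf.D j)
      have cG := He_cont (hg.D i)
      have h := J_ftc hT.le (Ψ := fun τ x => He v τ x * He g τ x)
        (ψ := fun τ x => τ * (He (D 0 (D 0 v)) τ x + He (D 1 (D 1 v)) τ x) * He g τ x + He v τ x * (τ * (He (D 0 (D 0 g)) τ x + He (D 1 (D 1 g)) τ x)))
        (by fun_prop) (fun τ => (He_slice hv τ).mul (He_slice hg τ)) (fun x τ => (He_deriv hv x τ).mul (He_deriv hg x τ))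
      rw [← h, J_congr (Θ' := fun z => 2 * (z.1 * (He (D j f) z.1 z.2 * He (D i g) z.1 z.2))) (by fun_prop) (by fun_prop), J_const, abs_mul, abs_two]
      · gcongr
        refine J_abs.trans (le_trans (J_mono (by fun_prop) (by fun_prop) fun z hz => ?_) (hC f g hf hg A B hA hB hfA hgB T hT.le j i))
        rw [abs_mul, abs_mul, abs_of_nonneg hz]
      · intro τ
        have sV := hv.He τ
        have sG := hg.He τ
        have sF := hf.He τ
        have lap := He_lap i j hf τ
        rw [← hvdef] at lap
        simp only [← D_He (hv.D _), ← D_He hv, ← D_He (hg.D _), ← D_He hg, ← D_He hf]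
        have c1 := (sF.D j).cont
        have c2 := (sG.D i).cont
        refine int_div (X := (-2 * τ) • (D j (He f τ) * He g τ)) (Y := τ • (He v τ * D 0 (He g τ)) - τ • (D 0 (He v τ) * He g τ))
          (Z := τ • (He v τ * D 1 (He g τ)) - τ • (D 1 (He v τ) * He g τ)) (W := fun _ => 0) (by fun_prop)
          (((sF.D j).mul sG).smul _) ((sV.mul (sG.D 0)).smul _ |>.sub (((sV.D 0).mul sG).smul _))
          ((sV.mul (sG.D 1)).smul _ |>.sub (((sV.D 1).mul sG).smul _)) (Sm.const 0) i 0 1 0 fun x => ?_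
        rw [D_smul _ _ ((sF.D j).mul sG), D_mul _ (sF.D j) sG,
          D_sub _ ((sV.mul (sG.D 0)).smul _) (((sV.D 0).mul sG).smul _),
          D_sub _ ((sV.mul (sG.D 1)).smul _) (((sV.D 1).mul sG).smul _),
          D_smul _ _ (sV.mul (sG.D 0)), D_smul _ _ (sV.mul (sG.D 1)), D_smul _ _ ((sV.D 0).mul sG), D_smul _ _ ((sV.D 1).mul sG),
          D_mul _ sV (sG.D 0), D_mul _ sV (sG.D 1), D_mul _ (sV.D 0) sG, D_mul _ (sV.D 1) sG]
        have hc : D 0 (fun _ : ℝ × ℝ => (0:ℝ)) x = 0 := by simp [D]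
        have := lap x
        simp only [Pi.add_apply, Pi.sub_apply, Pi.smul_apply, Pi.mul_apply, smul_eq_mul, hc]
        linear_combination (2 * τ * He g τ x) * this
  simp only [He_zero] at key
  calc _ ≤ _ := le_abs_self _
    _ ≤ _ := key
    _ ≤ _ := by nlinarith [mul_pos hA hB]
end

noncomputable section
set_option linter.unusedSectionVars false
open Set Filter Topology ProbabilityTheory
open scoped ContDiff

lemma D_mul3 {f g h : ℝ × ℝ → ℝ} (k : Fin 2) (hf : Sm f) (hg : Sm g) (hh : Sm h) (x : ℝ × ℝ) :
    D k (f * g * h) x = D k f x * g x * h x + f x * D k g x * h x + f x * g x * D k h x := by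
  rw [D_mul k (hf.mul hg) hh, D_mul k hf hg]
  simp only [Pi.add_apply, Pi.mul_apply]; ring

/-- error term -/
def Er (i j : Fin 2) (B V F G W : ℝ × ℝ → ℝ) (x : ℝ × ℝ) : ℝ :=
  (V x * D 0 (D 0 B) x * G x + V x * D 1 (D 1 B) x * G x)
  + (D 0 B x * D 0 V x * G x + D 1 B x * D 1 V x * G x)
  + (D 0 B x * D 0 F x * W x + D 1 B x * D 1 F x * W x)
  + F x * D i (D j B) x * G x + (D j B x * D i F x * G x + D i B x * D j F x * G x)

/-- auxiliary field -/
def Fi (a : Fin 2) (B V F G W : ℝ × ℝ → ℝ) : ℝ × ℝ → ℝ :=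
  B * V * D a G - B * D a V * G + (B * F * D a W - B * D a F * W) - (D a B * V * G + D a B * F * W)

lemma Fi_sm (a : Fin 2) {B V F G W : ℝ × ℝ → ℝ} (hB : Sm B) (hV : Sm V) (hF : Sm F) (hG : Sm G) (hW : Sm W) :
    Sm (Fi a B V F G W) :=
  ((((hB.mul hV).mul (hG.D a)).sub ((hB.mul (hV.D a)).mul hG)).add (((hB.mul hF).mul (hW.D a)).sub ((hB.mul (hF.D a)).mul hW))).sub
    ((((hB.D a).mul hV).mul hG).add (((hB.D a).mul hF).mul hW))

lemma Fi_D (a : Fin 2) {B V F G W : ℝ × ℝ → ℝ} (hB : Sm B) (hV : Sm V) (hF : Sm F) (hG : Sm G) (hW : Sm W) (x : ℝ × ℝ) :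
    D a (Fi a B V F G W) x = B x * V x * D a (D a G) x - B x * D a (D a V) x * G x
     + B x * F x * D a (D a W) x - B x * D a (D a F) x * W x
     - D a (D a B) x * V x * G x - D a (D a B) x * F x * W x
     - 2 * (D a B x * D a V x * G x) - 2 * (D a B x * D a F x * W x) := by
  rw [Fi, D_sub a ((((hB.mul hV).mul (hG.D a)).sub ((hB.mul (hV.D a)).mul hG)).add (((hB.mul hF).mul (hW.D a)).sub ((hB.mul (hF.D a)).mul hW)))
    ((((hB.D a).mul hV).mul hG).add (((hB.D a).mul hF).mul hW)),
    D_add a (((hB.mul hV).mul (hG.D a)).sub ((hB.mul (hV.D a)).mul hG)) (((hB.mul hF).mul (hW.D a)).sub ((hB.mul (hF.D a)).mul hW)),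
    D_sub a ((hB.mul hV).mul (hG.D a)) ((hB.mul (hV.D a)).mul hG), D_sub a ((hB.mul hF).mul (hW.D a)) ((hB.mul (hF.D a)).mul hW),
    D_add a (((hB.D a).mul hV).mul hG) (((hB.D a).mul hF).mul hW)]
  simp only [Pi.add_apply, Pi.sub_apply]
  rw [D_mul3 a hB hV (hG.D a), D_mul3 a hB (hV.D a) hG, D_mul3 a hB hF (hW.D a), D_mul3 a hB (hF.D a) hW,
    D_mul3 a (hB.D a) hV hG, D_mul3 a (hB.D a) hF hW]
  ring

lemma Er_cont (i j : Fin 2) {B V F G W : ℝ × ℝ → ℝ} (hB : Sm B) (hV : Sm V) (hF : Sm F) (hG : Sm G) (hW : Sm W) :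
    Continuous (Er i j B V F G W) := by
  have := hB.cont; have := hV.cont; have := hF.cont; have := hG.cont; have := hW.cont
  have := fun a => (hB.D a).cont
  have := fun a => (hV.D a).cont
  have := fun a => (hF.D a).cont
  have := fun a b => ((hB.D a).D b).cont
  unfold Er
  fun_prop

lemma tri_id (i j : Fin 2) {B V F G W : ℝ × ℝ → ℝ} (hB : Sm B) (hV : Sm V) (hF : Sm F) (hG : Sm G) (hW : Sm W)
    (lV : ∀ x, D 0 (D 0 V) x + D 1 (D 1 V) x = - D i (D j F) x)
    (lW : ∀ x, D 0 (D 0 W) x + D 1 (D 1 W) x = - D i (D j G) x) :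
    ∫ x in Q2, ((D 0 (D 0 B) x + D 1 (D 1 B) x) * (V x * G x - F x * W x)
      + B x * ((D 0 (D 0 V) x + D 1 (D 1 V) x) * G x + V x * (D 0 (D 0 G) x + D 1 (D 1 G) x)
        - ((D 0 (D 0 F) x + D 1 (D 1 F) x) * W x + F x * (D 0 (D 0 W) x + D 1 (D 1 W) x)))) =
    ∫ x in Q2, 2 * Er i j B V F G W x := by
  have cE := Er_cont i j hB hV hF hG hW
  have s1 := (hB.mul (hF.D j)).mul hG
  have s2 := ((hB.D j).mul hF).mul hG
  have s3 := (hB.mul hF).mul (hG.D i)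
  refine int_div (X := (-2 : ℝ) • (B * D j F * G + D j B * F * G)) (Y := (2 : ℝ) • (B * F * D i G)) (Z := Fi 0 B V F G W) (W := Fi 1 B V F G W)
    (by fun_prop) ((s1.add s2).smul _) (s3.smul _) (Fi_sm 0 hB hV hF hG hW) (Fi_sm 1 hB hV hF hG hW) i j 0 1 fun x => ?_
  rw [Fi_D 0 hB hV hF hG hW, Fi_D 1 hB hV hF hG hW, D_smul _ _ (s1.add s2), D_smul _ _ s3, D_add _ s1 s2]
  simp only [Pi.add_apply, Pi.smul_apply, smul_eq_mul]
  rw [D_mul3 i hB (hF.D j) hG, D_mul3 i (hB.D j) hF hG, D_mul3 j hB hF (hG.D i), D_comm j i hG]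
  unfold Er
  linear_combination (2 * B x * G x) * lV x - (2 * B x * F x) * lW x

/-- bounded terms -/
def Bd (T M : ℝ) (Θ : ℝ × (ℝ × ℝ) → ℝ) : Prop := Continuous Θ ∧ J T (fun z => |Θ z|) ≤ M

lemma Bd.add {T M M' : ℝ} {Θ Θ' : ℝ × (ℝ × ℝ) → ℝ} (h : Bd T M Θ) (h' : Bd T M' Θ') : Bd T (M + M') (fun z => Θ z + Θ' z) := by
  have c := h.1
  have c' := h'.1
  refine ⟨by fun_prop, (J_mono (by fun_prop) (by fun_prop) fun z _ => abs_add_le _ _).trans ?_⟩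
  rw [J_add (by fun_prop) (by fun_prop)]
  exact add_le_add h.2 h'.2

lemma Bd.of {T M : ℝ} {f g h : ℝ × ℝ → ℝ} (hf : Sm f) (hg : Sm g) (hh : Sm h)
    (H : J T (fun z => z.1 * (|He h z.1 z.2| * |He f z.1 z.2| * |He g z.1 z.2|)) ≤ M) :
    Bd T M (fun z => z.1 * (He h z.1 z.2 * He f z.1 z.2 * He g z.1 z.2)) := by
  have := He_cont hf; have := He_cont hg; have := He_cont hh
  refine ⟨by fun_prop, le_trans (J_mono (by fun_prop) (by fun_prop) fun z hz => ?_) H⟩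
  rw [abs_mul, abs_mul, abs_mul, abs_of_nonneg hz]

lemma tri_bound {p q r : ℝ} (hp : 1 < p) (hq : 1 < q) (hr : 1 < r) (h : 1 / p + 1 / q + 1 / r = 1) :
    ∃ C, 0 < C ∧ ∀ i j k, ∀ b f g : ℝ × ℝ → ℝ, Sm b → Sm f → Sm g → ∀ A B E, 0 < A → 0 < B → 0 < E →
    (∀ a, ∫ x in Q2, |D a b x| ^ p ≤ A ^ p) → ∫ x in Q2, |f x| ^ q ≤ B ^ q → ∫ x in Q2, |g x| ^ r ≤ E ^ r →
    |∫ x in Q2, b x * (Tr i j f x * D k g x - f x * D k (Tr i j g) x)| ≤ C * (A * B * E) := by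
  obtain ⟨R3, hR3, H3⟩ := riesz hq
  obtain ⟨R1, hR1, H1⟩ := riesz hr
  obtain ⟨Ca, ha, Ha⟩ := TL hp hr hq (by linarith)
  obtain ⟨Cb, hb, Hb⟩ := TL hq hr hp (by linarith)
  refine ⟨2 * (2 * (Ca * R3) + 2 * (Cb * R3) + 2 * (Cb * R1) + Ca + 2 * Cb) + 1, by positivity, ?_⟩
  intro i j k b f g sb sf sg A B E hA hB hE bA fB gE
  have sv := Tr_sm i j sf
  have sw := Tr_sm i j sg
  have vB := H3 i j f sf B hB fB
  have wE := H1 i j g sg E hE gE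
  have lW0 := Tr_D i j sg k
  set v := Tr i j f with hv
  set w := Tr i j g with hw
  have key : |∫ x in Q2, He b 0 x * (He v 0 x * He (D k g) 0 x - He f 0 x * He (D k w) 0 x)| ≤
      2 * (2 * (Ca * R3) + 2 * (Cb * R3) + 2 * (Cb * R1) + Ca + 2 * Cb) * (A * B * E) := by
    obtain ⟨Kb, hKb0, hKb⟩ := sb.bound
    obtain ⟨Kv, hKv0, hKv⟩ := sv.bound
    obtain ⟨Kf, hKf0, hKf⟩ := sf.bound
    obtain ⟨Kg, hKg0, hKg⟩ := He_D_decay sg k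
    obtain ⟨Kw, hKw0, hKw⟩ := He_D_decay sw k
    refine lim_le (Ψ := fun T => ∫ x in Q2, He b T x * (He v T x * He (D k g) T x - He f T x * He (D k w) T x))
      (C := Kb * (Kv * Kg + Kf * Kw)) (fun T hT => ?_) (fun T hT => ?_)
    · refine abs_int_le fun x hx => ?_
      rw [abs_mul, mul_div_assoc, add_div, mul_div_assoc, mul_div_assoc]
      have a1 := He_bound hKb T x
      have a2 := He_bound hKv T x
      have a3 := He_bound hKf T x
      have a4 := hKg T hT x
      have a5 := hKw T hT x
      refine mul_le_mul a1 ((abs_sub _ _).trans ?_) (abs_nonneg _) hKb0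
      rw [abs_mul, abs_mul]
      gcongr
    · have cc : ∀ {u : ℝ × ℝ → ℝ}, Sm u → Continuous fun z : ℝ × (ℝ × ℝ) => He u z.1 z.2 := fun hu => He_cont hu
      have sG := sg.D k
      have sW := sw.D k
      have cb := He_cont sb
      have cv := He_cont sv
      have cf := He_cont sf
      have cG := He_cont sG
      have cW := He_cont sW
      have cbD := fun a => He_cont (sb.D a)
      have cvD := fun a => He_cont (sv.D a)
      have cfD := fun a => He_cont (sf.D a)
      have cbDD := fun a c => He_cont ((sb.D a).D c)
      have cvDD := fun a c => He_cont ((sv.D a).D c)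
      have cfDD := fun a c => He_cont ((sf.D a).D c)
      have cGDD := fun a c => He_cont ((sG.D a).D c)
      have cWDD := fun a c => He_cont ((sW.D a).D c)
      have h := J_ftc hT.le (Ψ := fun τ x => He b τ x * (He v τ x * He (D k g) τ x - He f τ x * He (D k w) τ x))
        (ψ := fun τ x => τ * (He (D 0 (D 0 b)) τ x + He (D 1 (D 1 b)) τ x) * (He v τ x * He (D k g) τ x - He f τ x * He (D k w) τ x)
          + He b τ x * ((τ * (He (D 0 (D 0 v)) τ x + He (D 1 (D 1 v)) τ x) * He (D k g) τ x + He v τ x * (τ * (He (D 0 (D 0 (D k g))) τ x + He (D 1 (D 1 (D k g))) τ x)))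
            - (τ * (He (D 0 (D 0 f)) τ x + He (D 1 (D 1 f)) τ x) * He (D k w) τ x + He f τ x * (τ * (He (D 0 (D 0 (D k w))) τ x + He (D 1 (D 1 (D k w))) τ x)))))
        (by fun_prop) (fun τ => (He_slice sb τ).mul (((He_slice sv τ).mul (He_slice sG τ)).sub ((He_slice sf τ).mul (He_slice sW τ))))
        (fun x τ => (He_deriv sb x τ).mul (((He_deriv sv x τ).mul (He_deriv sG x τ)).sub ((He_deriv sf x τ).mul (He_deriv sW x τ))))
      have AB : 0 < R3 * B := by positivity
      have AE : 0 < R1 * E := by positivity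
      have t1 : ∀ a, Bd T _ _ := fun a => Bd.of ((sb.D a).D a) (sg.D k) sv (Ha (D a b) g v (sb.D a) sg sv A E _ hA hE AB (bA a) gE vB T hT.le a k)
      have t2 : ∀ a, Bd T _ _ := fun a => Bd.of (sv.D a) (sg.D k) (sb.D a) (Hb v g (D a b) sv sg (sb.D a) _ E A AB hE hA vB gE (bA a) T hT.le a k)
      have t3 : ∀ a, Bd T _ _ := fun a => Bd.of (sf.D a) (sw.D k) (sb.D a) (Hb f w (D a b) sf sw (sb.D a) B _ A hB AE hA fB wE (bA a) T hT.le a k)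
      have t4 := Bd.of ((sb.D j).D i) (sg.D k) sf (Ha (D j b) g f (sb.D j) sg sf A E B hA hE hB (bA j) gE fB T hT.le i k)
      have t5 := Bd.of (sf.D i) (sg.D k) (sb.D j) (Hb f g (D j b) sf sg (sb.D j) B E A hB hE hA fB gE (bA j) T hT.le i k)
      have t6 := Bd.of (sf.D j) (sg.D k) (sb.D i) (Hb f g (D i b) sf sg (sb.D i) B E A hB hE hA fB gE (bA i) T hT.le j k)
      have t := ((((t1 0).add (t1 1)).add ((t2 0).add (t2 1))).add ((t3 0).add (t3 1))).add (t4.add (t5.add t6))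
      rw [← h, J_congr (Θ' := fun z => 2 * ((((z.1 * (He v z.1 z.2 * He (D 0 (D 0 b)) z.1 z.2 * He (D k g) z.1 z.2) +
                z.1 * (He v z.1 z.2 * He (D 1 (D 1 b)) z.1 z.2 * He (D k g) z.1 z.2)) +
              (z.1 * (He (D 0 b) z.1 z.2 * He (D 0 v) z.1 z.2 * He (D k g) z.1 z.2) +
                z.1 * (He (D 1 b) z.1 z.2 * He (D 1 v) z.1 z.2 * He (D k g) z.1 z.2))) +
            (z.1 * (He (D 0 b) z.1 z.2 * He (D 0 f) z.1 z.2 * He (D k w) z.1 z.2) +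
              z.1 * (He (D 1 b) z.1 z.2 * He (D 1 f) z.1 z.2 * He (D k w) z.1 z.2))) +
          (z.1 * (He f z.1 z.2 * He (D i (D j b)) z.1 z.2 * He (D k g) z.1 z.2) +
            (z.1 * (He (D j b) z.1 z.2 * He (D i f) z.1 z.2 * He (D k g) z.1 z.2) +
              z.1 * (He (D i b) z.1 z.2 * He (D j f) z.1 z.2 * He (D k g) z.1 z.2))))) (by fun_prop) (by fun_prop), J_const, abs_mul, abs_two, mul_assoc]
      · gcongr
        refine (J_abs.trans t.2).trans (le_of_eq ?_)
        ring
      · intro τ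
        have lV := He_lap i j sf τ
        have lW := He_lap i j sG τ
        rw [← lW0] at lW
        rw [← hv] at lV
        have id := tri_id i j (sb.He τ) (sv.He τ) (sf.He τ) (sG.He τ) (sW.He τ) lV lW
        have id2 := congrArg (fun y => τ * y) id
        simp only [← integral_const_mul] at id2
        simp only [← D_He (sb.D _), ← D_He sb, ← D_He (sv.D _), ← D_He sv, ← D_He (sf.D _), ← D_He sf, ← D_He (sG.D _), ← D_He (sW.D _), ← D_He sG, ← D_He sW] at id2 ⊢
        refine Eq.trans ?_ (id2.trans ?_)
        · congr 1; funext x; ring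
        · congr 1; funext x; unfold Er; ring
  simp only [He_zero] at key
  refine key.trans ?_
  gcongr
  linarith

lemma comm_bound {q₁ q₂ q₃ : ℝ} (hq₁ : 1 < q₁) (hq₂ : 1 < q₂) (hq₃ : 1 < q₃) (hq : 1 / q₁ = 1 / q₂ + 1 / q₃) :
    ∃ C, 0 < C ∧ ∀ i j k, ∀ b f : ℝ × ℝ → ℝ, Sm b → Sm f → ∀ A B, 0 < A → 0 < B →
    (∀ a, ∫ x in Q2, |D a b x| ^ q₂ ≤ A ^ q₂) → ∫ x in Q2, |f x| ^ q₃ ≤ B ^ q₃ →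
    ∫ x in Q2, |D k (b * Tr i j f - Tr i j (b * f)) x| ^ q₁ ≤ (C * (A * B)) ^ q₁ := by
  obtain ⟨r, hr, hpr⟩ : ∃ q, 1 < q ∧ 1 / q₁ + 1 / q = 1 := by
    refine ⟨q₁ / (q₁ - 1), ?_, ?_⟩
    · rw [lt_div_iff₀ (by linarith)]; linarith
    · have : q₁ - 1 ≠ 0 := by linarith
      field_simp; ring
  obtain ⟨C, hC0, hC⟩ := tri_bound hq₂ hq₃ hr (by linarith)
  refine ⟨C, hC0, fun i j k b f sb sf A B hA hB bA fB => ?_⟩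
  have sv := Tr_sm i j sf
  have su := Tr_sm i j (sb.mul sf)
  have sc := (sb.mul sv).sub su
  refine dual hq₁ hr hpr (sc.D k) (by positivity) fun g sg E hE gE => ?_
  have key := hC i j k b f g sb sf sg A B E hA hB hE bA fB gE
  have e : ∫ x in Q2, D k (b * Tr i j f - Tr i j (b * f)) x * g x =
      -∫ x in Q2, b x * (Tr i j f x * D k g x - f x * D k (Tr i j g) x) := by
    have h1 := int_D (sc.mul sg) k
    rw [D_mul k sc sg] at h1
    have h2 : (∫ x in Q2, (b * Tr i j f - Tr i j (b * f)) x * D k g x) + ∫ x in Q2, D k (b * Tr i j f - Tr i j (b * f)) x * g x = 0 :=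
      (integral_add (intOn (sc.mul (sg.D k)).cont) (intOn ((sc.D k).mul sg).cont)).symm.trans h1
    have h3 : ∫ x in Q2, (b * Tr i j f - Tr i j (b * f)) x * D k g x = (∫ x in Q2, (b * Tr i j f * D k g) x) - ∫ x in Q2, Tr i j (b * f) x * D k g x := by
      refine Eq.trans ?_ (integral_sub (intOn ((sb.mul sv).mul (sg.D k)).cont) (intOn (su.mul (sg.D k)).cont))
      congr 1; funext x; simp; ring
    have h4 : ∫ x in Q2, b x * (Tr i j f x * D k g x - f x * D k (Tr i j g) x) = (∫ x in Q2, (b * Tr i j f * D k g) x) - ∫ x in Q2, (b * f) x * D k (Tr i j g) x := by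
      refine Eq.trans ?_ (integral_sub (intOn ((sb.mul sv).mul (sg.D k)).cont) (intOn ((sb.mul sf).mul ((Tr_sm i j sg).D k)).cont))
      congr 1; funext x; simp; ring
    rw [Tr_symm i j (sb.mul sf) (sg.D k), ← Tr_D i j sg] at h3
    linarith
  rw [e]
  have := neg_abs_le (∫ x in Q2, b x * (Tr i j f x * D k g x - f x * D k (Tr i j g) x))
  calc _ ≤ _ := by linarith
    _ ≤ _ := key
    _ = _ := by ring
end

noncomputable section
set_option linter.unusedSectionVars false
open Set Filter Topology ProbabilityTheory
open scoped ContDiff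

lemma eLp_eq {V : Type} [NormedAddCommGroup V] [NormedSpace ℝ V] [SecondCountableTopology V] {u : ℝ × ℝ → V} (hu : Sm u) {q : ℝ} (hq : 1 < q) :
    eLpNorm u (ENNReal.ofReal q) μΩ = ENNReal.ofReal ((∫ x in Q2, ‖u x‖ ^ q) ^ (1 / q)) := by
  obtain ⟨C, _, hC⟩ := hu.bound
  have hm : MemLp u (ENNReal.ofReal q) (volume.restrict Q2) := MemLp.of_bound hu.cont.aestronglyMeasurable C (ae_of_all _ hC)
  have h := hm.eLpNorm_eq_integral_rpow_norm (by simp; linarith) (by simp)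
  rw [μΩ, h, ENNReal.toReal_ofReal (by linarith), one_div]

lemma comm_eq (b f : ℝ × ℝ → ℝ) (i j : Fin 2) :
    commRR (fun y => (b y : ℂ)) (fun y => (f y : ℂ)) i j = fun x => (((b * Tr i j f - Tr i j (b * f)) x : ℝ) : ℂ) := by
  funext x
  simp only [commRR, ← Tr_coe, Pi.sub_apply, Pi.mul_apply, Complex.ofReal_sub, Complex.ofReal_mul]
  congr 1
  have := Tr_coe i j (b * f) x
  simp only [Pi.mul_apply, Complex.ofReal_mul] at this
  exact this.symm

lemma main8 (q₁ q₂ q₃ : ℝ) (hq₁ : 1 < q₁) (hq₂ : 1 < q₂) (hq₃ : 1 < q₃)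
    (hq : 1 / q₁ = 1 / q₂ + 1 / q₃) :
    ∃ C > 0, ∀ b f : ℝ × ℝ → ℝ, Per b → Per f → ContDiff ℝ (⊤ : ℕ∞) b → ContDiff ℝ (⊤ : ℕ∞) f →
      ∀ i j : Fin 2,
        MeasureTheory.eLpNorm
            (fun x => ‖fderiv ℝ (commRR (fun y => (b y : ℂ)) (fun y => (f y : ℂ)) i j) x‖)
            (ENNReal.ofReal q₁) μΩ ≤
          ENNReal.ofReal C *
            MeasureTheory.eLpNorm (fun x => ‖fderiv ℝ b x‖) (ENNReal.ofReal q₂) μΩ *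
            MeasureTheory.eLpNorm f (ENNReal.ofReal q₃) μΩ := by
  obtain ⟨C, hC0, hC⟩ := comm_bound hq₁ hq₂ hq₃ hq
  refine ⟨2 * C, by positivity, fun b f pb pf cb cf i j => ?_⟩
  have sb : Sm b := ⟨pb, cb⟩
  have sf : Sm f := ⟨pf, cf⟩
  set c := b * Tr i j f - Tr i j (b * f) with hc
  have sc : Sm c := (sb.mul (Tr_sm i j sf)).sub (Tr_sm i j (sb.mul sf))
  rw [comm_eq, ← hc, eLpNorm_norm (fderiv ℝ b), eLp_eq sb.fderiv hq₂, eLp_eq sf hq₃]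
  set N2 := (∫ x in Q2, ‖fderiv ℝ b x‖ ^ q₂) ^ (1 / q₂) with hN2
  set N3 := (∫ x in Q2, ‖f x‖ ^ q₃) ^ (1 / q₃) with hN3
  have i2 : 0 ≤ ∫ x in Q2, ‖fderiv ℝ b x‖ ^ q₂ := integral_nonneg fun x => by positivity
  have i3 : 0 ≤ ∫ x in Q2, ‖f x‖ ^ q₃ := integral_nonneg fun x => by positivity
  have n2 : 0 ≤ N2 := by positivity
  have n3 : 0 ≤ N3 := by positivity
  have e2 : N2 ^ q₂ = ∫ x in Q2, ‖fderiv ℝ b x‖ ^ q₂ := by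
    rw [hN2, ← rpow_mul i2, one_div_mul_cancel (by linarith), rpow_one]
  have e3 : N3 ^ q₃ = ∫ x in Q2, ‖f x‖ ^ q₃ := by
    rw [hN3, ← rpow_mul i3, one_div_mul_cancel (by linarith), rpow_one]
  have hle : ∀ x, ‖fderiv ℝ (fun x => ((c x : ℝ) : ℂ)) x‖ ≤ ‖D 0 c x‖ + ‖D 1 c x‖ := by
    intro x
    refine (norm_L_le _).trans (le_of_eq ?_)
    have := fun k => congrFun (D_coe sc k) x
    have a0 := this 0
    have a1 := this 1
    simp only [D] at a0 a1 ⊢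
    rw [a0, a1, Complex.norm_real, Complex.norm_real]
  have ee1 : ∀ k : Fin 2, ‖ee k‖ ≤ 1 := by
    intro k; fin_cases k <;> simp [ee, Prod.norm_def]
  have hk : ∀ ε > 0, ∀ k, eLpNorm (D k c) (ENNReal.ofReal q₁) μΩ ≤ ENNReal.ofReal (C * ((N2 + ε) * (N3 + ε))) := by
    intro ε hε k
    have h := hC i j k b f sb sf (N2 + ε) (N3 + ε) (by positivity) (by positivity) (fun a => by
        calc ∫ x in Q2, |D a b x| ^ q₂ ≤ ∫ x in Q2, ‖fderiv ℝ b x‖ ^ q₂ := by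
              refine setIntegral_mono (intOn (cont_abs_rpow (by linarith) (sb.D a).cont))
                (intOn (sb.fderiv.cont.norm.rpow_const fun _ => Or.inr (by linarith))) fun x => ?_
              refine rpow_le_rpow (abs_nonneg _) ?_ (by linarith)
              rw [← Real.norm_eq_abs]
              refine ((fderiv ℝ b x).le_opNorm (ee a)).trans ?_
              exact mul_le_of_le_one_right (norm_nonneg _) (ee1 a)
          _ = N2 ^ q₂ := e2.symm
          _ ≤ _ := rpow_le_rpow n2 (by linarith) (by linarith)) (by
        calc ∫ x in Q2, |f x| ^ q₃ = N3 ^ q₃ := e3.symm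
          _ ≤ _ := rpow_le_rpow n3 (by linarith) (by linarith))
    rw [← hc] at h
    rw [eLp_eq (sc.D k) hq₁]
    apply ENNReal.ofReal_le_ofReal
    have pos : 0 ≤ C * ((N2 + ε) * (N3 + ε)) := by positivity
    calc _ ≤ ((C * ((N2 + ε) * (N3 + ε))) ^ q₁) ^ (1 / q₁) := 
          rpow_le_rpow (integral_nonneg fun x => by positivity) h (by positivity)
      _ = _ := by rw [← rpow_mul pos, mul_one_div_cancel (by linarith), rpow_one]
  have hε : ∀ ε > 0, eLpNorm (fun x => ‖fderiv ℝ (fun x => ((c x : ℝ) : ℂ)) x‖) (ENNReal.ofReal q₁) μΩ ≤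
      ENNReal.ofReal (2 * (C * ((N2 + ε) * (N3 + ε)))) := by
    intro ε hε
    calc _ ≤ eLpNorm ((fun x => ‖D 0 c x‖) + fun x => ‖D 1 c x‖) (ENNReal.ofReal q₁) μΩ :=
          eLpNorm_mono_real fun x => by rw [norm_norm]; exact hle x
      _ ≤ eLpNorm (fun x => ‖D 0 c x‖) (ENNReal.ofReal q₁) μΩ + eLpNorm (fun x => ‖D 1 c x‖) (ENNReal.ofReal q₁) μΩ :=
          eLpNorm_add_le (sc.D 0).cont.norm.aestronglyMeasurable (sc.D 1).cont.norm.aestronglyMeasurable (by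
            rw [← ENNReal.ofReal_one]; exact ENNReal.ofReal_le_ofReal hq₁.le)
      _ ≤ _ := by
          rw [eLpNorm_norm, eLpNorm_norm, two_mul, ENNReal.ofReal_add (by positivity) (by positivity)]
          exact add_le_add (hk ε hε 0) (hk ε hε 1)
  have lim : Tendsto (fun ε : ℝ => ENNReal.ofReal (2 * (C * ((N2 + ε) * (N3 + ε))))) (𝓝[>] 0) (𝓝 (ENNReal.ofReal (2 * (C * (N2 * N3))))) := by
    have : Continuous fun ε : ℝ => ENNReal.ofReal (2 * (C * ((N2 + ε) * (N3 + ε)))) := ENNReal.continuous_ofReal.comp (by fun_prop)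
    have := this.tendsto 0
    simp only [add_zero] at this
    exact this.mono_left nhdsWithin_le_nhds
  refine (ge_of_tendsto lim (eventually_mem_nhdsWithin.mono fun ε h => hε ε h)).trans (le_of_eq ?_)
  rw [← ENNReal.ofReal_mul (by positivity), ← ENNReal.ofReal_mul (by positivity)]
  congr 1; ring
end

/-- Coifman–Meyer `W^{1,p}` commutator estimate. For exponents
`q₁, q₂, q₃ ∈ (1,∞)` with `1/q₁ = 1/q₂ + 1/q₃`, there is `C` such that
`‖∇[b, R_iR_j](f)‖_{L^{q₁}} ≤ C ‖∇b‖_{L^{q₂}} ‖f‖_{L^{q₃}}`. -/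
theorem stmt8 (q₁ q₂ q₃ : ℝ) (hq₁ : 1 < q₁) (hq₂ : 1 < q₂) (hq₃ : 1 < q₃)
    (hq : 1 / q₁ = 1 / q₂ + 1 / q₃) :
    ∃ C > 0, ∀ b f : ℝ × ℝ → ℝ, Per b → Per f → ContDiff ℝ (⊤ : ℕ∞) b → ContDiff ℝ (⊤ : ℕ∞) f →
      ∀ i j : Fin 2,
        MeasureTheory.eLpNorm
            (fun x => ‖fderiv ℝ (commRR (fun y => (b y : ℂ)) (fun y => (f y : ℂ)) i j) x‖)
            (ENNReal.ofReal q₁) μΩ ≤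
          ENNReal.ofReal C *
            MeasureTheory.eLpNorm (fun x => ‖fderiv ℝ b x‖) (ENNReal.ofReal q₂) μΩ *
            MeasureTheory.eLpNorm f (ENNReal.ofReal q₃) μΩ := by
  exact main8 q₁ q₂ q₃ hq₁ hq₂ hq₃ hq
end
end
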